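/- arXiv:2505.03287 — 5 statements merged into one kernel-verified Lean document; each statement's English description precedes it below -/
import Mathlib

section
/- Let M be a von Neumann algebra (or more generally a unital C*-algebra with real rank zero) and let p be a nonzero projection in M. Then Sph(Sph({p})) = {p}, where for S ⊆ S_{M⁺}, Sph(S) = {x positive, norm one : ‖x − s‖ = 1 for all s ∈ S}. -/
variable {H : Type*} [NormedAddCommGroup H] [InnerProductSpace ℂ H] [CompleteSpace H]

/-- The unit sphere around a subset `S` inside the positive unit sphere of a
von Neumann algebra `M`. -/
def Sph (M : VonNeumannAlgebra H) (S : Set (H →L[ℂ] H)) : Set (H →L[ℂ] H) :=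
  {x : H →L[ℂ] H | x ∈ M ∧ 0 ≤ x ∧ ‖x‖ = 1 ∧ ∀ s ∈ S, ‖x - s‖ = 1}

theorem IsStarProjection.norm_eq_one {A : Type*} [CStarAlgebra A] {p : A}
    (hp : IsStarProjection p) (h0 : p ≠ 0) :
    ‖p‖ = 1 := by
  have h := CStarRing.norm_star_mul_self (x := p)
  rw [hp.isSelfAdjoint.star_eq, hp.isIdempotentElem.eq] at h
  have := norm_pos_iff.2 h0
  nlinarith

theorem StarSubalgebra.real_smul_mem {A : Type*} [CStarAlgebra A] (S : StarSubalgebra ℂ A) (r : ℝ)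
    {a : A} (ha : a ∈ S) : r • a ∈ S := by
  rw [← Complex.coe_smul]
  exact S.smul_mem ha _

section CStarAlgebra

variable {A : Type*} [CStarAlgebra A] [PartialOrder A] [StarOrderedRing A]

theorem norm_le_of_neg_le_of_le {y : A} {r : ℝ} (hr : 0 ≤ r) (h₁ : -(r • (1 : A)) ≤ y)
    (h₂ : y ≤ r • (1 : A)) : ‖y‖ ≤ r := by
  cases subsingleton_or_nontrivial A
  · simpa [Subsingleton.elim y 0] using hr
  rw [← Algebra.algebraMap_eq_smul_one] at h₁ h₂
  have hy : IsSelfAdjoint y := by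
    have h := (sub_nonneg.2 h₂).isSelfAdjoint
    simpa using (IsSelfAdjoint.algebraMap A (IsSelfAdjoint.all r)).sub h
  rw [← map_neg, algebraMap_le_iff_le_spectrum] at h₁
  rw [le_algebraMap_iff_spectrum_le] at h₂
  rcases CStarAlgebra.norm_or_neg_norm_mem_spectrum hy with h | h
  · exact h₂ _ h
  · linarith [h₁ _ h]

theorem mul_self_le_self_of_norm_le_one {u : A} (hu : 0 ≤ u) (hu1 : ‖u‖ ≤ 1) : u * u ≤ u := by
  have h : 0 ≤ 1 - u := sub_nonneg.2 ((CStarAlgebra.norm_le_one_iff_of_nonneg u).1 hu1)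
  have h₁ := add_nonneg (conjugate_nonneg_of_nonneg h hu) (conjugate_nonneg_of_nonneg hu h)
  rw [← sub_nonneg]
  convert h₁ using 1
  noncomm_ring

/-- If `u` is positive of norm one then any `y` with `u * y = (u + u * u) / 2` has norm at least
one. -/
theorem one_le_norm_of_mul_eq {u y : A} (hu : 0 ≤ u) (hu1 : ‖u‖ = 1)
    (h : u * y = (1 / 2 : ℝ) • (u + u * u)) : 1 ≤ ‖y‖ := by
  have huu : ‖u * u‖ = 1 := by
    have h := CStarRing.norm_star_mul_self (x := u)
    rwa [hu.isSelfAdjoint.star_eq, hu1, mul_one] at h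
  have hle : u * u ≤ u * y := by
    have h₁ := smul_nonneg (by norm_num : (0 : ℝ) ≤ 1 / 2)
      (sub_nonneg.2 (mul_self_le_self_of_norm_le_one hu hu1.le))
    rw [← sub_nonneg, h]
    convert h₁ using 1
    module
  calc 1 = ‖u * u‖ := huu.symm
    _ ≤ ‖u * y‖ := CStarAlgebra.norm_le_norm_of_nonneg_of_le hu.isSelfAdjoint.mul_self_nonneg hle
    _ ≤ ‖u‖ * ‖y‖ := norm_mul_le _ _
    _ = ‖y‖ := by rw [hu1, one_mul]

theorem StarSubalgebra.exists_norm_sub_lt_one_of_compression_ne_zero (S : StarSubalgebra ℂ A)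
    {p a : A} (hp : IsStarProjection p) (hpS : p ∈ S) (haS : a ∈ S) (ha : 0 ≤ a) (ha1 : ‖a‖ = 1)
    (h : (1 - p) * a * (1 - p) ≠ 0) :
    ∃ x ∈ S, 0 ≤ x ∧ ‖x‖ = 1 ∧ ‖x - p‖ = 1 ∧ ‖a - x‖ < 1 := by
  have hq := hp.one_sub
  have hb0 : 0 ≤ (1 - p) * a * (1 - p) := conjugate_nonneg_of_nonneg ha hq.nonneg
  have hβ : 0 < ‖(1 - p) * a * (1 - p)‖ := norm_pos_iff.2 h
  have hbS : (1 - p) * a * (1 - p) ∈ S :=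
    mul_mem (mul_mem (sub_mem (one_mem S) hpS) haS) (sub_mem (one_mem S) hpS)
  have hbp : (1 - p) * a * (1 - p) * p = 0 := by
    rw [mul_assoc, hp.one_sub_mul_self, mul_zero]
  have hbq : (1 - p) * ((1 - p) * a * (1 - p)) * (1 - p) = (1 - p) * a * (1 - p) := by
    have hqq := hq.isIdempotentElem.eq
    rw [mul_assoc, mul_assoc, hqq, ← mul_assoc, ← mul_assoc, hqq]
  have hb2 : (1 - p) * a * (1 - p) ≤ (2 : ℝ) • a + (2 : ℝ) • p := by
    have h₁ : 0 ≤ (1 + p) * a * (1 + p) :=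
      conjugate_nonneg_of_nonneg ha (add_nonneg zero_le_one hp.nonneg)
    have h₂ : p * a * p ≤ p := by
      have := conjugate_le_conjugate_of_nonneg
        ((CStarAlgebra.norm_le_one_iff_of_nonneg a).1 ha1.le) hp.nonneg
      rwa [mul_one, hp.isIdempotentElem.eq] at this
    rw [← sub_nonneg]
    convert add_nonneg h₁ (smul_nonneg (zero_le_two (α := ℝ)) (sub_nonneg.2 h₂)) using 1
    simp only [two_smul]
    noncomm_ring
  have hb1 : ‖(1 - p) * a * (1 - p)‖ ≤ 1 := by
    have h₁ := conjugate_le_conjugate_of_nonneg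
      ((CStarAlgebra.norm_le_one_iff_of_nonneg a).1 ha1.le) hq.nonneg
    rw [mul_one, hq.isIdempotentElem.eq] at h₁
    exact (CStarAlgebra.norm_le_one_iff_of_nonneg _).2 (h₁.trans hq.le_one)
  generalize (1 - p) * a * (1 - p) = b at *
  set β := ‖b‖ with hβdef
  obtain ⟨u, hu⟩ : ∃ u, u = β⁻¹ • b := ⟨_, rfl⟩
  have hbu : b = β • u := by rw [hu, smul_inv_smul₀ hβ.ne']
  have hu0 : 0 ≤ u := hu ▸ smul_nonneg (inv_nonneg.2 hβ.le) hb0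
  have hu1 : ‖u‖ = 1 := by
    rw [hu, norm_smul, Real.norm_of_nonneg (inv_nonneg.2 hβ.le), ← hβdef, inv_mul_cancel₀ hβ.ne']
  have hule : u ≤ 1 := (CStarAlgebra.norm_le_one_iff_of_nonneg u).1 hu1.le
  have hup : u * p = 0 := by rw [hu, smul_mul_assoc, hbp, smul_zero]
  have huq : u ≤ 1 - p := by
    have h₁ := conjugate_le_conjugate_of_nonneg hule hq.nonneg
    rwa [mul_one, hq.isIdempotentElem.eq, hu, mul_smul_comm, smul_mul_assoc, hbq, ← hu] at h₁
  have hx0 : 0 ≤ (1 / 2 : ℝ) • (1 + u) :=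
    smul_nonneg (by norm_num) (add_nonneg zero_le_one hu0)
  have hx1 : (1 / 2 : ℝ) • (1 + u) ≤ 1 := by
    rw [← sub_nonneg]
    convert smul_nonneg (by norm_num : (0 : ℝ) ≤ 1 / 2) (sub_nonneg.2 hule) using 1
    module
  refine ⟨(1 / 2 : ℝ) • (1 + u), ?_, hx0, le_antisymm ?_ ?_, le_antisymm ?_ ?_, ?_⟩
  · rw [hu]
    exact S.real_smul_mem _ (add_mem (one_mem S) (S.real_smul_mem _ hbS))
  · exact (CStarAlgebra.norm_le_one_iff_of_nonneg _).2 hx1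
  · exact one_le_norm_of_mul_eq hu0 hu1 (by rw [mul_smul_comm, mul_add, mul_one])
  · refine norm_le_of_neg_le_of_le (by linarith) ?_ ?_
    · rw [one_smul]
      refine (neg_le_neg hp.le_one).trans ?_
      simpa only [neg_le_sub_iff_le_add, le_add_iff_nonneg_left] using hx0
    · rw [one_smul]
      exact (sub_le_self _ hp.nonneg).trans hx1
  · refine one_le_norm_of_mul_eq hu0 hu1 ?_
    rw [mul_sub, hup, sub_zero, mul_smul_comm, mul_add, mul_one]
  · suffices ‖a - (1 / 2 : ℝ) • (1 + u)‖ ≤ 1 - β / 8 by linarith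
    refine norm_le_of_neg_le_of_le (by linarith) ?_ ?_
    · have h₁ := smul_nonneg (by norm_num : (0 : ℝ) ≤ 1 / 8) (sub_nonneg.2 hb2)
      have h₂ := smul_nonneg (by norm_num : (0 : ℝ) ≤ 1 / 4) (sub_nonneg.2 huq)
      have h₃ := smul_nonneg (by linarith : (0 : ℝ) ≤ (2 - β) / 8) (sub_nonneg.2 hule)
      have h₄ := smul_nonneg (by norm_num : (0 : ℝ) ≤ 3 / 4) ha
      rw [hbu] at h₁
      rw [← sub_nonneg]
      convert add_nonneg (add_nonneg h₁ h₂) (add_nonneg h₃ h₄) using 1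
      module
    · have h₁ := sub_nonneg.2 ((CStarAlgebra.norm_le_one_iff_of_nonneg a).1 ha1.le)
      have h₂ := smul_nonneg (by norm_num : (0 : ℝ) ≤ 1 / 2) hu0
      have h₃ := smul_nonneg (by linarith : (0 : ℝ) ≤ 1 / 2 - β / 8) (zero_le_one (α := A))
      rw [← sub_nonneg]
      convert add_nonneg (add_nonneg h₁ h₂) h₃ using 1
      module

theorem StarSubalgebra.exists_norm_sub_lt_one_of_ne (S : StarSubalgebra ℂ A)
    {p a : A} (hp : IsStarProjection p) (hpS : p ∈ S) (haS : a ∈ S) (ha : 0 ≤ a) (ha1 : ‖a‖ = 1)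
    (h : (1 - p) * a * (1 - p) = 0) (hne : a ≠ p) :
    ∃ x ∈ S, 0 ≤ x ∧ ‖x‖ = 1 ∧ ‖x - p‖ = 1 ∧ ‖a - x‖ < 1 := by
  have hq := hp.one_sub
  have hale : a ≤ 1 := (CStarAlgebra.norm_le_one_iff_of_nonneg a).1 ha1.le
  have haq : a * (1 - p) = 0 := by
    obtain ⟨s, rfl⟩ := CStarAlgebra.nonneg_iff_eq_star_mul_self.1 ha
    have h₁ : star (s * (1 - p)) * (s * (1 - p)) = 0 := by
      rw [star_mul, hq.isSelfAdjoint.star_eq, ← h]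
      simp only [mul_assoc]
    rw [CStarRing.star_mul_self_eq_zero_iff] at h₁
    rw [mul_assoc, h₁, mul_zero]
  have hap : a * p = a := by
    rw [mul_sub, mul_one, sub_eq_zero] at haq
    exact haq.symm
  have hpa : p * a = a := by
    have := congrArg star hap
    rwa [star_mul, ha.isSelfAdjoint.star_eq, hp.isSelfAdjoint.star_eq] at this
  have hpap : p * a * p = a := by rw [hpa, hap]
  have halep : a ≤ p := by
    have h₁ := conjugate_le_conjugate_of_nonneg hale hp.nonneg
    rwa [mul_one, hp.isIdempotentElem.eq, hpap] at h₁
  have hc0 : 0 ≤ p - a := sub_nonneg.2 halep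
  have hcS : p - a ∈ S := sub_mem hpS haS
  have hγ : 0 < ‖p - a‖ := norm_pos_iff.2 (sub_ne_zero.2 hne.symm)
  have hγ1 : ‖p - a‖ ≤ 1 := (CStarAlgebra.norm_le_one_iff_of_nonneg _).2
    ((sub_le_self _ ha).trans hp.le_one)
  have hcp : p - a ≤ ‖p - a‖ • p := by
    have h₁ := conjugate_le_conjugate_of_nonneg hc0.isSelfAdjoint.le_algebraMap_norm_self hp.nonneg
    rwa [Algebra.algebraMap_eq_smul_one, mul_smul_comm, mul_one, smul_mul_assoc,
      hp.isIdempotentElem.eq, mul_sub, sub_mul, hpap, hp.isIdempotentElem.eq,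
      hp.isIdempotentElem.eq] at h₁
  obtain ⟨c, hc⟩ : ∃ c, c = p - a := ⟨_, rfl⟩
  rw [← hc] at hc0 hcS hγ hγ1 hcp
  have hac : a = p - c := by rw [hc, sub_sub_cancel]
  set γ := ‖c‖ with hγdef
  have hx0 : 0 ≤ p - γ⁻¹ • c := by
    convert smul_nonneg (inv_nonneg.2 hγ.le) (sub_nonneg.2 hcp) using 1
    rw [smul_sub, inv_smul_smul₀ hγ.ne']
  have hx1 : p - γ⁻¹ • c ≤ 1 :=
    (sub_le_self _ (smul_nonneg (inv_nonneg.2 hγ.le) hc0)).trans hp.le_one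
  refine ⟨p - γ⁻¹ • c, ?_, hx0, le_antisymm ?_ ?_, ?_, ?_⟩
  · exact sub_mem hpS (S.real_smul_mem _ hcS)
  · exact (CStarAlgebra.norm_le_one_iff_of_nonneg _).2 hx1
  · have h₁ : a = γ • (p - γ⁻¹ • c) + (1 - γ) • p := by
      rw [hac, smul_sub, smul_inv_smul₀ hγ.ne']
      module
    have h₂ : ‖a‖ ≤ γ * ‖p - γ⁻¹ • c‖ + (1 - γ) * ‖p‖ := by
      conv_lhs => rw [h₁]
      refine (norm_add_le _ _).trans_eq ?_
      rw [norm_smul, norm_smul, Real.norm_of_nonneg hγ.le, Real.norm_of_nonneg (sub_nonneg.2 hγ1)]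
    nlinarith [hp.norm_le]
  · rw [sub_sub_cancel_left, norm_neg, norm_smul, Real.norm_of_nonneg (inv_nonneg.2 hγ.le),
      ← hγdef, inv_mul_cancel₀ hγ.ne']
  · have h₁ : a - (p - γ⁻¹ • c) = (γ⁻¹ - 1) • c := by
      rw [hac]
      module
    rw [h₁, norm_smul, Real.norm_of_nonneg (sub_nonneg.2 ((one_le_inv₀ hγ).2 hγ1)), ← hγdef,
      sub_mul, inv_mul_cancel₀ hγ.ne']
    linarith

end CStarAlgebra

/-- For a nonzero projection `p` in a von Neumann algebra `M`, the double sphere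
around `p` is exactly `{p}`. -/
theorem double_sphere_of_projection (M : VonNeumannAlgebra H) (p : H →L[ℂ] H)
    (hpM : p ∈ M) (hp : IsSelfAdjoint p) (hp2 : IsIdempotentElem p) (hp0 : p ≠ 0) :
    Sph M (Sph M ({p} : Set (H →L[ℂ] H))) = {p} := by
  have hP : IsStarProjection p := ⟨hp2, hp⟩
  refine Set.Subset.antisymm ?_ ?_
  · rintro a ⟨haM, ha, ha1, hdist⟩
    by_contra hne
    obtain ⟨x, hxM, hx, hx1, hxp, hax⟩ :
        ∃ x ∈ M.toStarSubalgebra, 0 ≤ x ∧ ‖x‖ = 1 ∧ ‖x - p‖ = 1 ∧ ‖a - x‖ < 1 := by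
      by_cases h : (1 - p) * a * (1 - p) = 0
      · exact M.toStarSubalgebra.exists_norm_sub_lt_one_of_ne hP hpM haM ha ha1 h hne
      · exact M.toStarSubalgebra.exists_norm_sub_lt_one_of_compression_ne_zero
          hP hpM haM ha ha1 h
    refine hax.ne (hdist x ⟨hxM, hx, hx1, ?_⟩)
    rintro s rfl
    exact hxp
  · rw [Set.singleton_subset_iff]
    exact ⟨hpM, hP.nonneg, hP.norm_eq_one hp0, fun s hs ↦ norm_sub_rev s p ▸ hs.2.2.2 p rfl⟩
end

section
/- Let M be a von Neumann algebra and let p, q be nonzero projections in M. Then p and q are orthogonal if and only if ‖r − s‖ = 1 for every pair of nonzero projections r, s in M with r ≤ p and s ≤ q. -/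
variable {H : Type*} [NormedAddCommGroup H] [InnerProductSpace ℂ H] [CompleteSpace H]

open ContinuousLinearMap

/-- The projection onto the closure of the range of `x`. -/
noncomputable def rangeProjection (x : H →L[ℂ] H) : H →L[ℂ] H :=
  x.range.topologicalClosure.starProjection

theorem isStarProjection_rangeProjection (x : H →L[ℂ] H) :
    IsStarProjection (rangeProjection x) :=
  isStarProjection_starProjection

theorem rangeProjection_apply_apply (x : H →L[ℂ] H) (v : H) :
    rangeProjection x (x v) = x v :=
  Submodule.starProjection_eq_self_iff.mpr
    (Submodule.le_topologicalClosure _ (LinearMap.mem_range_self _ v))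

theorem rangeProjection_ne_zero {x : H →L[ℂ] H} (hx : x ≠ 0) : rangeProjection x ≠ 0 := by
  intro h
  refine hx (ContinuousLinearMap.ext fun v => ?_)
  simpa [h] using (rangeProjection_apply_apply x v).symm

theorem rangeProjection_induction {x : H →L[ℂ] H} {P : H → Prop} (hP : IsClosed {v | P v})
    (h : ∀ v, P (x v)) (v : H) : P (rangeProjection x v) := by
  have hv : rangeProjection x v ∈ closure (x.range : Set H) :=
    Submodule.starProjection_apply_mem x.range.topologicalClosure v
  refine closure_minimal ?_ hP hv
  rintro _ ⟨w, rfl⟩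
  exact h w

theorem mul_rangeProjection {x y : H →L[ℂ] H} (h : y * x = x) :
    y * rangeProjection x = rangeProjection x := by
  ext v
  exact rangeProjection_induction (P := fun w => y w = w)
    (isClosed_eq y.continuous continuous_id) (fun w => congr($h w)) v

theorem rangeProjection_mem {M : VonNeumannAlgebra H} {x : H →L[ℂ] H} (hx : x ∈ M) :
    rangeProjection x ∈ M := by
  rw [VonNeumannAlgebra.IsStarProjection.mem_iff (isStarProjection_rangeProjection x)]
  intro y hy
  have hxy := VonNeumannAlgebra.mem_commutant_iff.mp hy x hx
  have h : rangeProjection x * (y * rangeProjection x) = y * rangeProjection x := by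
    ext v
    refine rangeProjection_induction
      (P := fun w => rangeProjection x (y w) = y w)
      (isClosed_eq (by fun_prop) (by fun_prop)) (fun w => ?_) v
    have h₁ : y (x w) = x (y w) := congr($hxy.symm w)
    rw [h₁, rangeProjection_apply_apply]
  rw [Module.End.mem_invtSubmodule]
  rintro _ ⟨w, rfl⟩
  exact ⟨y (rangeProjection x w), congr($h w)⟩

/-- A von Neumann algebra is closed under the real continuous functional calculus. -/
theorem VonNeumannAlgebra.cfc_real_mem {M : VonNeumannAlgebra H} {a : H →L[ℂ] H} (ha : a ∈ M)
    (f : ℝ → ℝ) : cfc f a ∈ M := by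
  rw [← M.commutant_commutant, VonNeumannAlgebra.mem_commutant_iff]
  intro y hy
  have h : Commute a y := VonNeumannAlgebra.mem_commutant_iff.mp hy a ha
  exact (h.cfc_real f).symm.eq

theorem IsStarProjection.inner_apply_apply {e : H →L[ℂ] H} (he : IsStarProjection e) (v w : H) :
    inner ℂ (e v) w = inner ℂ (e v) (e w) := by
  rw [← adjoint_inner_left, ← star_eq_adjoint, he.isSelfAdjoint.star_eq]
  exact congr(inner ℂ ($he.isIdempotentElem.symm v) w)

theorem IsStarProjection.norm_sq_eq {e : H →L[ℂ] H} (he : IsStarProjection e) (v : H) :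
    ‖v‖ ^ 2 = ‖e v‖ ^ 2 + ‖v - e v‖ ^ 2 := by
  have h : inner ℂ (e v) (v - e v) = 0 := by
    rw [inner_sub_right, he.inner_apply_apply, sub_self]
  have := norm_add_sq_eq_norm_sq_add_norm_sq_of_inner_eq_zero (e v) (v - e v) h
  rw [add_sub_cancel] at this
  linarith

/-- Two projections, each of which is bounded below on the range of the other, are at distance
less than one. -/
theorem IsStarProjection.norm_sub_lt_one {r s : H →L[ℂ] H} (hr : IsStarProjection r)
    (hs : IsStarProjection s) {c : ℝ} (hc : 0 < c)
    (hrs : ∀ v, c * ‖r v‖ ^ 2 ≤ ‖s (r v)‖ ^ 2) (hsr : ∀ v, c * ‖s v‖ ^ 2 ≤ ‖r (s v)‖ ^ 2) :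
    ‖r - s‖ < 1 := by
  wlog hc1 : c ≤ 1 generalizing c
  · have hc2 : 1 ≤ c := (not_le.mp hc1).le
    refine this one_pos (fun v => le_trans ?_ (hrs v)) (fun v => le_trans ?_ (hsr v)) le_rfl
    all_goals gcongr
  have hr2 : ∀ v, r (r v) = r v := fun v => congr($hr.isIdempotentElem v)
  have key : ∀ x, ‖(r - s) x‖ ^ 2 ≤ (1 - c) * ‖x‖ ^ 2 := by
    intro x
    have h₁ := hr.norm_sq_eq ((r - s) x)
    have e₁ : r ((r - s) x) = r (x - s x) := by simp [hr2]
    have e₂ : (r - s) x - r ((r - s) x) = -(s x - r (s x)) := by simp [hr2]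
    rw [e₂, e₁, norm_neg] at h₁
    have h₂ := hr.norm_sq_eq (s x)
    have h₃ := hsr x
    have h₄ := hs.norm_sq_eq x
    set u := r (x - s x) with hu
    have h₅ : c * ‖u‖ ^ 2 ≤ ‖s u‖ ^ 2 := hrs _
    have h₆ := hs.norm_sq_eq u
    have h₇ : inner ℂ u u = inner ℂ (u - s u) (x - s x) := by
      have i₁ : inner ℂ u u = inner ℂ u (x - s x) := (hr.inner_apply_apply _ _).symm
      have i₂ : inner ℂ (s u) (x - s x) = 0 := by
        rw [inner_sub_right, hs.inner_apply_apply, sub_self]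
      rw [i₁, inner_sub_left, i₂, sub_zero]
    have h₈ : ‖u‖ ^ 2 ≤ ‖u - s u‖ * ‖x - s x‖ := by
      have := norm_inner_le_norm (𝕜 := ℂ) (u - s u) (x - s x)
      rwa [← h₇, inner_self_eq_norm_sq_to_K, norm_pow, RCLike.norm_ofReal, abs_norm] at this
    have h₉ : ‖u‖ ^ 2 ≤ (1 - c) * ‖x - s x‖ ^ 2 := by
      rcases (norm_nonneg u).eq_or_lt with h0 | h0
      · have : 0 ≤ (1 - c) * ‖x - s x‖ ^ 2 := mul_nonneg (by linarith) (sq_nonneg _)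
        rw [← h0]; simpa using this
      · have h10 : (‖u‖ ^ 2) ^ 2 ≤ ((1 - c) * ‖u‖ ^ 2) * ‖x - s x‖ ^ 2 := by
          calc (‖u‖ ^ 2) ^ 2 ≤ (‖u - s u‖ * ‖x - s x‖) ^ 2 := by gcongr
            _ = ‖u - s u‖ ^ 2 * ‖x - s x‖ ^ 2 := by ring
            _ ≤ _ := by gcongr; linarith
        have : 0 < ‖u‖ ^ 2 := by positivity
        nlinarith
    nlinarith
  refine (opNorm_le_bound _ (Real.sqrt_nonneg (1 - c)) fun x => ?_).trans_lt
    ((Real.sqrt_lt' one_pos).mpr (by linarith))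
  refine (abs_le_of_sq_le_sq' ?_ (by positivity)).2
  rw [mul_pow, Real.sq_sqrt (by linarith)]
  exact key x

theorem IsStarProjection.norm_eq_one_s10 {e : H →L[ℂ] H} (he : IsStarProjection e) (h0 : e ≠ 0) :
    ‖e‖ = 1 := by
  have h : ‖e‖ = ‖e‖ * ‖e‖ := by
    conv_lhs => rw [← he.isIdempotentElem.eq]
    conv_lhs => rw [← congr($(he.isSelfAdjoint.star_eq) * e), CStarRing.norm_star_mul_self]
  have : ‖e‖ ≠ 0 := norm_ne_zero_iff.mpr h0
  field_simp at h
  exact h.symm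

/-- Orthogonal nonzero projections are at distance one. -/
theorem IsStarProjection.norm_sub_eq_one {r s : H →L[ℂ] H} (hr : IsStarProjection r)
    (hs : IsStarProjection s) (hr0 : r ≠ 0) (h : r * s = 0) : ‖r - s‖ = 1 := by
  have h' : s * r = 0 := by
    simpa [hr.isSelfAdjoint.star_eq, hs.isSelfAdjoint.star_eq] using congr(star $h)
  have hrr := hr.isIdempotentElem.eq
  have hss := hs.isIdempotentElem.eq
  have hadd : IsStarProjection (r + s) :=
    ⟨by simp [IsIdempotentElem, mul_add, add_mul, h, h', hrr, hss],
      hr.isSelfAdjoint.add hs.isSelfAdjoint⟩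
  have hadd0 : r + s ≠ 0 := by
    intro h0
    apply hr0
    simpa [mul_add, h, hrr] using congr(r * $h0)
  have hsq : star (r - s) * (r - s) = r + s := by
    rw [(hr.isSelfAdjoint.sub hs.isSelfAdjoint).star_eq]
    simp [mul_sub, sub_mul, h, h', hrr, hss]
  have := CStarRing.norm_star_mul_self (x := r - s)
  rw [hsq, hadd.norm_eq_one_s10 hadd0] at this
  nlinarith [norm_nonneg (r - s)]

/-- A nonzero positive operator `a` of a von Neumann algebra is bounded below on the range of some
nonzero `f` in the algebra that factors through `a`. -/
theorem exists_cutoff {M : VonNeumannAlgebra H} {a : H →L[ℂ] H} (haM : a ∈ M) (ha : 0 ≤ a)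
    (ha0 : a ≠ 0) :
    ∃ f ∈ M, f ≠ 0 ∧ (∃ g, f = a * g) ∧
      ∃ c : ℝ, 0 < c ∧ ∀ v, c * ‖f v‖ ^ 2 ≤ (inner ℂ (a (f v)) (f v)).re := by
  set c : ℝ := ‖a‖ / 2 with hc
  have hn : 0 < ‖a‖ := norm_pos_iff.mpr ha0
  have hc0 : 0 < c := by positivity
  have hsa : IsSelfAdjoint a := ha.isSelfAdjoint
  set f := cfc (fun t : ℝ => max (t - c) 0) a with hf
  have hf0 : 0 ≤ f := cfc_nonneg fun t _ => le_max_right _ _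
  have hmul : a * f = c • f + f * f := by
    have e₁ : a * f = cfc (fun t : ℝ => t * max (t - c) 0) a := by
      rw [cfc_mul (fun t : ℝ => t) _ a, cfc_id' ℝ a]
    have e₂ : c • f + f * f = cfc (fun t : ℝ => c • max (t - c) 0 +
        max (t - c) 0 * max (t - c) 0) a := by
      rw [cfc_add .., cfc_smul .., cfc_mul ..]
    rw [e₁, e₂]
    congr 1
    ext t
    rcases le_total (t - c) 0 with h | h
    · simp [h]
    · simp only [max_eq_left h, smul_eq_mul]; ring
  refine ⟨f, VonNeumannAlgebra.cfc_real_mem haM _, ?_,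
    ⟨cfc (fun t : ℝ => max (t - c) 0 / max t c) a, ?_⟩, c, hc0, fun v => ?_⟩
  · intro h
    have : Nontrivial (H →L[ℂ] H) := nontrivial_of_ne a 0 ha0
    have hmem : ‖a‖ ∈ spectrum ℝ a := CStarAlgebra.norm_mem_spectrum_of_nonneg ha
    have := norm_apply_le_norm_cfc (fun t : ℝ => max (t - c) 0) a hmem
    rw [← hf, h, norm_zero, norm_le_zero_iff] at this
    have := le_max_left (‖a‖ - c) 0
    linarith
  · have hcont : Continuous fun t : ℝ => max (t - c) 0 / max t c :=
      Continuous.div (by fun_prop) (by fun_prop) fun t => (lt_max_of_lt_right hc0).ne'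
    have : cfc (fun t : ℝ => t * (max (t - c) 0 / max t c)) a =
        a * cfc (fun t : ℝ => max (t - c) 0 / max t c) a := by
      rw [cfc_mul (fun t : ℝ => t) _ a (by fun_prop) hcont.continuousOn, cfc_id' ℝ a]
    rw [← this, hf]
    congr 1
    ext t
    rcases le_total t c with h | h
    · simp [h]
    · have : t ≠ 0 := (hc0.trans_le h).ne'
      rw [max_eq_left h]; field_simp
  · have h : a (f v) = (c : ℂ) • f v + f (f v) := by
      simpa using congr($hmul v)
    have hpos : 0 ≤ (inner ℂ (f (f v)) (f v)).re :=
      ((nonneg_iff_isPositive f).mp hf0).re_inner_nonneg_left (f v)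
    have hin : (inner ℂ (f v) (f v)).re = ‖f v‖ ^ 2 := by
      simpa using inner_self_eq_norm_sq (𝕜 := ℂ) (f v)
    rw [h, inner_add_left, inner_smul_left, Complex.add_re, Complex.conj_ofReal,
      Complex.re_ofReal_mul, hin]
    linarith

/-- Non-orthogonal projections have nonzero subprojections at distance less than one. -/
theorem exists_subproj_norm_sub_lt_one {M : VonNeumannAlgebra H} {p q : H →L[ℂ] H}
    (hpM : p ∈ M) (hqM : q ∈ M) (hp : IsStarProjection p) (hq : IsStarProjection q)
    (hpq : p * q ≠ 0) :
    ∃ r ∈ M, ∃ s ∈ M, IsStarProjection r ∧ r ≠ 0 ∧ r ≤ p ∧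
      IsStarProjection s ∧ s ≠ 0 ∧ s ≤ q ∧ ‖r - s‖ < 1 := by
  have hpp := hp.isIdempotentElem.eq
  have hqq := hq.isIdempotentElem.eq
  have ha : p * q * p = p * q * star (p * q) := by
    rw [star_mul, hp.isSelfAdjoint.star_eq, hq.isSelfAdjoint.star_eq, ← mul_assoc, mul_assoc p q q,
      hqq]
  obtain ⟨f, hfM, hf0, ⟨g, hg⟩, c, hc, hbound⟩ := exists_cutoff (M := M) (a := p * q * p)
    (mul_mem (mul_mem hpM hqM) hpM) (ha ▸ mul_star_self_nonneg _)
    (ha ▸ (CStarRing.mul_star_self_ne_zero_iff _).mpr hpq)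
  have hpf : p * f = f := by rw [hg, ← mul_assoc, ← mul_assoc, ← mul_assoc, hpp]
  have hpf' : ∀ v, p (f v) = f v := fun v => congr($hpf v)
  have hlow : ∀ v, c * ‖f v‖ ^ 2 ≤ ‖q (f v)‖ ^ 2 := by
    intro v
    have e : inner ℂ ((p * q * p) (f v)) (f v) = inner ℂ (q (f v)) (q (f v)) := by
      change inner ℂ (p (q (p (f v)))) (f v) = _
      rw [hpf' v, ← adjoint_inner_right, ← star_eq_adjoint,
        hp.isSelfAdjoint.star_eq, hpf' v, hq.inner_apply_apply]
    have := hbound v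
    rw [e] at this
    simpa using this.trans_eq (inner_self_eq_norm_sq (𝕜 := ℂ) (q (f v)))
  have hqf0 : q * f ≠ 0 := by
    intro h
    refine hf0 (ContinuousLinearMap.ext fun v => ?_)
    have h₁ : q (f v) = 0 := congr($h v)
    have h₂ := hlow v
    rw [h₁, norm_zero] at h₂
    have h₃ : ‖f v‖ ^ 2 ≤ 0 := by nlinarith
    simpa using h₃.antisymm (sq_nonneg _)
  set r := rangeProjection f with hr_def
  set s := rangeProjection (q * f) with hs_def
  have hr : IsStarProjection r := isStarProjection_rangeProjection f
  have hs : IsStarProjection s := isStarProjection_rangeProjection (q * f)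
  have hrp : r ≤ p := (hr.le_iff_mul_eq_right hp).mpr (mul_rangeProjection hpf)
  have hsq : s ≤ q := (hs.le_iff_mul_eq_right hq).mpr
    (mul_rangeProjection (by rw [← mul_assoc, hqq]))
  have hsq' : s * q = s := (hs.le_iff_mul_eq_left hq).mp hsq
  refine ⟨r, rangeProjection_mem hfM, s, rangeProjection_mem (mul_mem hqM hfM), hr,
    rangeProjection_ne_zero hf0, hrp, hs, rangeProjection_ne_zero hqf0, hsq,
    hr.norm_sub_lt_one hs hc (fun v => ?_) (fun v => ?_)⟩
  · refine rangeProjection_induction (P := fun w => c * ‖w‖ ^ 2 ≤ ‖s w‖ ^ 2)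
      (isClosed_le (by fun_prop) (by fun_prop)) (fun w => ?_) v
    have h : s (f w) = q (f w) := by
      rw [← hsq']
      exact rangeProjection_apply_apply (q * f) w
    rw [h]
    exact hlow w
  · refine rangeProjection_induction (P := fun w => c * ‖w‖ ^ 2 ≤ ‖r w‖ ^ 2)
      (isClosed_le (by fun_prop) (by fun_prop)) (fun w => ?_) v
    have hw : (q * f) w = q (f w) := rfl
    rw [hw]
    have h₁ : inner ℂ (r (q (f w))) (f w) = inner ℂ (q (f w)) (q (f w)) := by
      rw [← hq.inner_apply_apply, ← adjoint_inner_right, ← star_eq_adjoint,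
        hr.isSelfAdjoint.star_eq, rangeProjection_apply_apply]
    have h₂ : ‖q (f w)‖ ^ 2 ≤ ‖r (q (f w))‖ * ‖f w‖ := by
      have := norm_inner_le_norm (𝕜 := ℂ) (r (q (f w))) (f w)
      rwa [h₁, inner_self_eq_norm_sq_to_K, norm_pow, RCLike.norm_ofReal, abs_norm] at this
    have h₃ := hlow w
    rcases (norm_nonneg (q (f w))).eq_or_lt with h0 | h0
    · rw [← h0]; simp
    · have h₄ : (‖q (f w)‖ ^ 2) ^ 2 ≤ (‖r (q (f w))‖ * ‖f w‖) ^ 2 := by gcongr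
      have h₅ : c * (‖q (f w)‖ ^ 2) ^ 2 ≤ ‖r (q (f w))‖ ^ 2 * ‖q (f w)‖ ^ 2 :=
        calc c * (‖q (f w)‖ ^ 2) ^ 2 ≤ c * (‖r (q (f w))‖ * ‖f w‖) ^ 2 := by gcongr
          _ = ‖r (q (f w))‖ ^ 2 * (c * ‖f w‖ ^ 2) := by ring
          _ ≤ _ := by gcongr
      have : 0 < ‖q (f w)‖ ^ 2 := by positivity
      nlinarith

/-- Two nonzero projections `p, q` in a von Neumann algebra are orthogonal iff every pair of
nonzero subprojections `r ≤ p`, `s ≤ q` is at distance one. -/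
theorem orthogonal_iff_subproj_dist_one (M : VonNeumannAlgebra H) (p q : H →L[ℂ] H)
    (hpM : p ∈ M) (hqM : q ∈ M)
    (hp : IsSelfAdjoint p) (hp2 : IsIdempotentElem p) (hp0 : p ≠ 0)
    (hq : IsSelfAdjoint q) (hq2 : IsIdempotentElem q) (hq0 : q ≠ 0) :
    p * q = 0 ↔
      ∀ r s : H →L[ℂ] H, r ∈ M → s ∈ M →
        IsSelfAdjoint r → IsIdempotentElem r → r ≠ 0 → r ≤ p →
        IsSelfAdjoint s → IsIdempotentElem s → s ≠ 0 → s ≤ q → ‖r - s‖ = 1 := by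
  have hpP : IsStarProjection p := ⟨hp2, hp⟩
  have hqP : IsStarProjection q := ⟨hq2, hq⟩
  constructor
  · intro hpq r s _ _ hr hr2 hr0 hrp hs hs2 _ hsq
    have hrP : IsStarProjection r := ⟨hr2, hr⟩
    have hsP : IsStarProjection s := ⟨hs2, hs⟩
    refine hrP.norm_sub_eq_one hsP hr0 ?_
    rw [← (hrP.le_iff_mul_eq_left hpP).mp hrp, ← (hsP.le_iff_mul_eq_right hqP).mp hsq,
      mul_assoc, ← mul_assoc p, hpq, zero_mul, mul_zero]
  · intro h
    by_contra hpq
    obtain ⟨r, hrM, s, hsM, hr, hr0, hrp, hs, hs0, hsq, hlt⟩ :=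
      exists_subproj_norm_sub_lt_one hpM hqM hpP hqP hpq
    exact hlt.ne (h r s hrM hsM hr.isSelfAdjoint hr.isIdempotentElem hr0 hrp
      hs.isSelfAdjoint hs.isIdempotentElem hs0 hsq)
end

section
/- Let M be a von Neumann algebra and let p, q be nonzero projections in M. Then q ≤ p if and only if every positive norm-one invertible element a of M with ‖a − p‖ = 1 also satisfies ‖a − q‖ = 1. -/
variable {H : Type*} [NormedAddCommGroup H] [InnerProductSpace ℂ H] [CompleteSpace H]

/-- The norm of a self-adjoint operator is approximated by its quadratic form on unit vectors. -/
lemma exists_unit_lt_abs_re_inner {b : H →L[ℂ] H} (hb : IsSelfAdjoint b) {r : ℝ} (hr : 0 ≤ r)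
    (h : r < ‖b‖) : ∃ x : H, ‖x‖ = 1 ∧ r < |(inner ℂ (b x) x).re| := by
  rw [b.norm_eq_iSup_rayleighQuotient hb.isSymmetric] at h
  obtain ⟨x, hx⟩ := exists_lt_of_lt_ciSup h
  have hx0 : x ≠ 0 := by
    rintro rfl
    simp at hx
    linarith
  have hmem : b.rayleighQuotient x ∈ b.rayleighQuotient '' Metric.sphere 0 1 := by
    rw [← b.image_rayleigh_eq_image_rayleigh_sphere one_pos]
    exact ⟨x, hx0, rfl⟩
  obtain ⟨y, hy, hyx⟩ := hmem
  have hy1 : ‖y‖ = 1 := by simpa using hy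
  refine ⟨y, hy1, ?_⟩
  rw [← hyx] at hx
  simpa [ContinuousLinearMap.rayleighQuotient, ContinuousLinearMap.reApplyInnerSelf, hy1] using hx

lemma abs_re_inner_apply_self_le_norm {E : Type*} [NormedAddCommGroup E] [InnerProductSpace ℂ E]
    (b : E →L[ℂ] E) {x : E} (hx : ‖x‖ = 1) :
    |(inner ℂ (b x) x).re| ≤ ‖b‖ := by
  simpa [ContinuousLinearMap.rayleighQuotient, ContinuousLinearMap.reApplyInnerSelf, hx] using
    b.rayleighQuotient_le_norm x

lemma re_inner_star_mul_self_apply (T : H →L[ℂ] H) (x : H) :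
    (inner ℂ ((star T * T) x) x).re = ‖T x‖ ^ 2 := by
  rw [ContinuousLinearMap.star_eq_adjoint, mul_apply_eq_comp,
    ContinuousLinearMap.adjoint_inner_left, inner_self_eq_norm_sq_to_K]
  norm_cast

lemma re_inner_projection_apply {p : H →L[ℂ] H} (hp : IsSelfAdjoint p) (hp2 : IsIdempotentElem p)
    (x : H) : (inner ℂ (p x) x).re = ‖p x‖ ^ 2 := by
  rw [← re_inner_star_mul_self_apply, hp.star_eq, hp2.eq]

lemma norm_projection_apply_sq_add {p : H →L[ℂ] H} (hp : IsSelfAdjoint p)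
    (hp2 : IsIdempotentElem p) (x : H) : ‖(1 - p) x‖ ^ 2 + ‖p x‖ ^ 2 = ‖x‖ ^ 2 := by
  rw [← re_inner_projection_apply hp hp2,
    ← re_inner_projection_apply ((IsSelfAdjoint.one _).sub hp) hp2.one_sub]
  simp
  norm_cast

lemma re_inner_le_of_le {E : Type*} [NormedAddCommGroup E] [InnerProductSpace ℂ E]
    {a b : E →L[ℂ] E} (h : a ≤ b) (x : E) :
    (inner ℂ (a x) x).re ≤ (inner ℂ (b x) x).re := by
  have := ((ContinuousLinearMap.le_def a b).1 h).re_inner_nonneg_left x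
  simpa [inner_sub_left] using this

lemma norm_apply_sq_le_re_inner {a : H →L[ℂ] H} (ha : 0 ≤ a) (ha1 : a ≤ 1) (x : H) :
    ‖a x‖ ^ 2 ≤ (inner ℂ (a x) x).re := by
  have hsa : IsSelfAdjoint a := .of_nonneg ha
  have h1 : 0 ≤ a * (1 - a) * a := hsa.conjugate_nonneg (sub_nonneg.2 ha1)
  have h2 : 0 ≤ (1 - a) * a * (1 - a) :=
    ((IsSelfAdjoint.one _).sub hsa).conjugate_nonneg ha
  have h3 : a * a ≤ a := by
    rw [← sub_nonneg]
    convert add_nonneg h1 h2 using 1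
    noncomm_ring
  calc ‖a x‖ ^ 2 = (inner ℂ ((a * a) x) x).re := by
        rw [← re_inner_star_mul_self_apply, hsa.star_eq]
    _ ≤ _ := re_inner_le_of_le h3 x

/-- A positive invertible contraction is at distance one from a projection exactly when some
unit vectors are simultaneously almost fixed by the former and almost killed by the latter. -/
lemma norm_sub_projection_eq_one_iff {a p : H →L[ℂ] H} (ha : 0 ≤ a) (ha1 : ‖a‖ ≤ 1)
    (hinv : ∃ c : H →L[ℂ] H, c * a = 1) (hp : IsSelfAdjoint p) (hp2 : IsIdempotentElem p) :
    ‖a - p‖ = 1 ↔ ∀ δ > 0, ∃ x : H, ‖x‖ = 1 ∧ 1 - δ < (inner ℂ (a x) x).re ∧ ‖p x‖ ^ 2 < δ := by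
  have hle : a ≤ 1 := (CStarAlgebra.norm_le_one_iff_of_nonneg a ha).1 ha1
  have hsa : IsSelfAdjoint a := .of_nonneg ha
  have key (x : H) : (inner ℂ ((a - p) x) x).re = (inner ℂ (a x) x).re - ‖p x‖ ^ 2 := by
    rw [← re_inner_projection_apply hp hp2]
    simp
  have hα1 {x : H} (hx : ‖x‖ = 1) : (inner ℂ (a x) x).re ≤ 1 := by
    simpa [hx] using re_inner_le_of_le hle x
  have hα0 (x : H) : 0 ≤ (inner ℂ (a x) x).re := by
    simpa using re_inner_le_of_le ha x
  have hπ {x : H} (hx : ‖x‖ = 1) : ‖p x‖ ^ 2 ≤ 1 := by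
    have := norm_projection_apply_sq_add hp hp2 x
    rw [hx] at this
    nlinarith [sq_nonneg ‖(1 - p) x‖]
  constructor
  · intro h δ hδ
    obtain ⟨c, hc⟩ := hinv
    have hlow {x : H} (hx : ‖x‖ = 1) : 1 ≤ ‖c‖ ^ 2 * (inner ℂ (a x) x).re := by
      have h1 : ‖x‖ ≤ ‖c‖ * ‖a x‖ := by
        simpa [← mul_apply_eq_comp, hc] using c.le_opNorm (a x)
      rw [hx] at h1
      calc (1 : ℝ) ≤ (‖c‖ * ‖a x‖) ^ 2 := one_le_pow₀ h1
        _ = ‖c‖ ^ 2 * ‖a x‖ ^ 2 := mul_pow ..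
        _ ≤ _ := by gcongr; exact norm_apply_sq_le_re_inner ha hle x
    set K := ‖c‖ ^ 2 + 1 with hK
    have hK1 : 1 ≤ K := by have := sq_nonneg ‖c‖; linarith
    have hKinv : 0 < K⁻¹ := by positivity
    have hKinv1 : K⁻¹ ≤ 1 := inv_le_one_of_one_le₀ hK1
    obtain ⟨x, hx, hlt⟩ := exists_unit_lt_abs_re_inner (hsa.sub hp)
      (r := 1 - min δ K⁻¹) (by linarith [min_le_right δ K⁻¹])
      (by rw [h]; linarith [lt_min hδ hKinv])
    have hα : K⁻¹ ≤ (inner ℂ (a x) x).re := by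
      rw [inv_le_iff_one_le_mul₀ (by positivity)]
      nlinarith [hlow hx, hα0 x]
    have hm1 := min_le_left δ K⁻¹
    have hm2 := min_le_right δ K⁻¹
    have hπ0 := sq_nonneg ‖p x‖
    rw [key, lt_abs] at hlt
    have hα1x := hα1 hx
    have hπx := hπ hx
    refine ⟨x, hx, ?_⟩
    rcases hlt with hlt | hlt
    · constructor <;> linarith
    · linarith
  · intro h
    apply le_antisymm
    · by_contra! hgt
      obtain ⟨x, hx, hlt⟩ := exists_unit_lt_abs_re_inner (hsa.sub hp) zero_le_one hgt
      rw [key, lt_abs] at hlt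
      have := hα1 hx
      have := hα0 x
      have := hπ hx
      have := sq_nonneg ‖p x‖
      rcases hlt with hlt | hlt <;> linarith
    · refine le_of_forall_pos_sub_le fun ε hε ↦ ?_
      obtain ⟨x, hx, h1, h2⟩ := h (ε / 2) (by positivity)
      have := abs_re_inner_apply_self_le_norm (a - p) hx
      rw [key] at this
      have := (le_abs_self _).trans this
      linarith

lemma projection_le_of_mul_one_sub_eq_zero {p q : H →L[ℂ] H} (hp : IsSelfAdjoint p)
    (hp2 : IsIdempotentElem p) (hq : IsSelfAdjoint q) (hq2 : IsIdempotentElem q)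
    (h : q * (1 - p) = 0) : q ≤ p := by
  have hqp : q * p = q := by
    rw [mul_sub, mul_one, sub_eq_zero] at h
    exact h.symm
  have hpq : p * q = q := by
    simpa [hp.star_eq, hq.star_eq] using congr(star $hqp)
  have hid : p - q = (p - q) * (p - q) := by
    rw [sub_mul, mul_sub, mul_sub, hp2.eq, hq2.eq, hqp, hpq, sub_self, sub_zero]
  rw [← sub_nonneg, hid]
  exact (hp.sub hq).mul_self_nonneg

/-- A left and right inverse of an element of a von Neumann algebra belongs to the algebra. -/
lemma VonNeumannAlgebra.mem_of_mul_eq_one (M : VonNeumannAlgebra H) {a c : H →L[ℂ] H}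
    (ha : a ∈ M) (h1 : a * c = 1) (h2 : c * a = 1) : c ∈ M := by
  rw [← M.commutant_commutant, VonNeumannAlgebra.mem_commutant_iff]
  intro g hg
  have hag := VonNeumannAlgebra.mem_commutant_iff.1 hg a ha
  calc g * c = c * (a * g) * c := by rw [← mul_assoc, h2, one_mul]
    _ = c * g * (a * c) := by rw [hag]; simp only [mul_assoc]
    _ = c * g := by rw [h1, mul_one]

/-- For nonzero projections `p, q` in a von Neumann algebra `M`, one has `q ≤ p` iff
every positive norm-one invertible element `a` of `M` at distance one from `p`
is also at distance one from `q`. -/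
theorem le_iff_sphere_inclusion (M : VonNeumannAlgebra H) (p q : H →L[ℂ] H)
    (hpM : p ∈ M) (hqM : q ∈ M)
    (hp : IsSelfAdjoint p) (hp2 : IsIdempotentElem p) (hp0 : p ≠ 0)
    (hq : IsSelfAdjoint q) (hq2 : IsIdempotentElem q) (hq0 : q ≠ 0) :
    q ≤ p ↔
      ∀ a : H →L[ℂ] H, a ∈ M → 0 ≤ a → ‖a‖ = 1 →
        (∃ c : H →L[ℂ] H, c ∈ M ∧ a * c = 1 ∧ c * a = 1) →
        ‖a - p‖ = 1 → ‖a - q‖ = 1 := by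
  constructor
  · rintro hqp a - ha ha1 ⟨c, -, -, hc⟩ h
    rw [norm_sub_projection_eq_one_iff ha ha1.le ⟨c, hc⟩ hp hp2] at h
    rw [norm_sub_projection_eq_one_iff ha ha1.le ⟨c, hc⟩ hq hq2]
    intro δ hδ
    obtain ⟨x, hx, h1, h2⟩ := h δ hδ
    have := re_inner_le_of_le hqp x
    rw [re_inner_projection_apply hp hp2, re_inner_projection_apply hq hq2] at this
    exact ⟨x, hx, h1, this.trans_lt h2⟩
  · intro h
    by_contra hqp
    set T := q * (1 - p) with hT
    have hT0 : T ≠ 0 := fun h0 ↦ hqp (projection_le_of_mul_one_sub_eq_zero hp hp2 hq hq2 h0)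
    have hTpos : 0 < ‖T‖ := norm_pos_iff.2 hT0
    have hTsq : 0 < ‖T‖ ^ 2 := by positivity
    have hTM : T ∈ M := mul_mem hqM (sub_mem (one_mem M) hpM)
    -- the quadratic form of `a` is `(‖x‖ ^ 2 + ‖T x‖ ^ 2 / ‖T‖ ^ 2) / 2`
    set a : H →L[ℂ] H := (2⁻¹ : ℝ) • (1 + (‖T‖ ^ 2)⁻¹ • (star T * T)) with ha
    have hsT : 0 ≤ (‖T‖ ^ 2)⁻¹ • (star T * T) :=
      smul_nonneg (by positivity) (star_mul_self_nonneg T)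
    have ha0 : 0 ≤ a := smul_nonneg (by norm_num) (add_nonneg zero_le_one hsT)
    have hform {x : H} (hx : ‖x‖ = 1) :
        (inner ℂ (a x) x).re = (1 + (‖T‖ ^ 2)⁻¹ * ‖T x‖ ^ 2) / 2 := by
      have hreal (r : ℝ) (y z : H) : (inner ℂ (r • y) z).re = r * (inner ℂ y z).re := by
        rw [inner_smul_left_eq_smul, Complex.smul_re, smul_eq_mul]
      rw [ha, smul_apply, hreal, add_apply,
        inner_add_left, Complex.add_re, smul_apply, hreal,
        re_inner_star_mul_self_apply]
      simp [hx]
      ring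
    have hTp (x : H) : ‖T x‖ ^ 2 ≤ ‖T‖ ^ 2 * ‖(1 - p) x‖ ^ 2 := by
      have : T * (1 - p) = T := by rw [hT, mul_assoc, hp2.one_sub.eq]
      have h1 := T.le_opNorm ((1 - p) x)
      rw [← mul_apply_eq_comp, this] at h1
      rw [← mul_pow]
      gcongr
    have hpx {x : H} (hx : ‖x‖ = 1) : (‖T‖ ^ 2)⁻¹ * ‖T x‖ ^ 2 ≤ 1 - ‖p x‖ ^ 2 := by
      rw [inv_mul_le_iff₀ hTsq]
      have := norm_projection_apply_sq_add hp hp2 x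
      rw [hx, one_pow] at this
      rw [← eq_sub_iff_add_eq.2 this]
      exact hTp x
    have ha_le : ‖a‖ ≤ 1 := by
      by_contra! hgt
      obtain ⟨x, hx, hlt⟩ := exists_unit_lt_abs_re_inner (.of_nonneg ha0) zero_le_one hgt
      rw [hform hx, abs_of_nonneg (by positivity)] at hlt
      nlinarith [hpx hx, sq_nonneg ‖p x‖]
    have happrox : ∀ δ > 0, ∃ x : H, ‖x‖ = 1 ∧ 1 - δ < (‖T‖ ^ 2)⁻¹ * ‖T x‖ ^ 2 := by
      intro δ hδ
      by_cases hδ1 : 1 < δ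
      · obtain ⟨x, hx⟩ := DFunLike.ne_iff.1 hT0
        have hx0 : x ≠ 0 := by rintro rfl; simp at hx
        refine ⟨(‖x‖⁻¹ : ℝ) • x, by simp [norm_smul, hx0], ?_⟩
        have : 0 ≤ (‖T‖ ^ 2)⁻¹ * ‖T ((‖x‖⁻¹ : ℝ) • x)‖ ^ 2 := by positivity
        linarith
      · push Not at hδ1
        have hn : ‖star T * T‖ = ‖T‖ ^ 2 := by rw [CStarRing.norm_star_mul_self, sq]
        obtain ⟨x, hx, hlt⟩ := exists_unit_lt_abs_re_inner (.star_mul_self T)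
          (r := ‖T‖ ^ 2 * (1 - δ)) (mul_nonneg hTsq.le (by linarith)) (by rw [hn]; nlinarith)
        rw [re_inner_star_mul_self_apply, abs_of_nonneg (by positivity)] at hlt
        exact ⟨x, hx, (lt_inv_mul_iff₀ hTsq).2 hlt⟩
    have hunit : IsUnit a := by
      refine CStarAlgebra.isUnit_of_le ((2⁻¹ : ℝ) • (1 : H →L[ℂ] H)) ?_ ?_
      · rw [ha]
        exact smul_le_smul_of_nonneg_left (le_add_of_nonneg_right hsT) (by norm_num)
      · exact .smul (by norm_num) isStrictlyPositive_one
    obtain ⟨c, hac, hca⟩ := isUnit_iff_exists.1 hunit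
    have hreal_mem (r : ℝ) {b : H →L[ℂ] H} (hb : b ∈ M) : r • b ∈ M := by
      have : ((r : ℂ) • b) ∈ M.toStarSubalgebra := SMulMemClass.smul_mem (r : ℂ) hb
      simpa using this
    have haM : a ∈ M :=
      hreal_mem _ (add_mem (one_mem M) (hreal_mem _ (mul_mem (star_mem hTM) hTM)))
    have ha1 : ‖a‖ = 1 := by
      refine le_antisymm ha_le (le_of_forall_pos_sub_le fun δ hδ ↦ ?_)
      obtain ⟨x, hx, hlt⟩ := happrox δ hδ
      have := (le_abs_self _).trans (abs_re_inner_apply_self_le_norm a hx)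
      rw [hform hx] at this
      linarith
    have hap : ‖a - p‖ = 1 := by
      rw [norm_sub_projection_eq_one_iff ha0 ha_le ⟨c, hca⟩ hp hp2]
      intro δ hδ
      obtain ⟨x, hx, hlt⟩ := happrox δ hδ
      have := hpx hx
      refine ⟨x, hx, ?_, by linarith⟩
      rw [hform hx]
      linarith
    have haq := h a haM ha0 ha1 ⟨c, M.mem_of_mul_eq_one haM hac hca, hac, hca⟩ hap
    rw [norm_sub_projection_eq_one_iff ha0 ha_le ⟨c, hca⟩ hq hq2] at haq
    obtain ⟨x, hx, h1, h2⟩ := haq (‖T‖ ^ 2 / (7 + 2 * ‖T‖ ^ 2)) (by positivity)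
    set δ := ‖T‖ ^ 2 / (7 + 2 * ‖T‖ ^ 2) with hδ
    have hδeq : δ * (7 + 2 * ‖T‖ ^ 2) = ‖T‖ ^ 2 := div_mul_cancel₀ _ (by positivity)
    have hδ0 : 0 < δ := by positivity
    rw [hform hx] at h1
    have h3 := hpx hx
    have h4 : ‖T‖ ^ 2 * (1 - 2 * δ) < ‖T x‖ ^ 2 :=
      (lt_inv_mul_iff₀ hTsq).1 (by linarith)
    have hq1 (y : H) : ‖q y‖ ≤ ‖y‖ := by
      have := norm_projection_apply_sq_add hq hq2 y
      exact abs_le_of_sq_le_sq' (by nlinarith [sq_nonneg ‖(1 - q) y‖]) (norm_nonneg _) |>.2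
    have h5 : ‖T x‖ ≤ ‖q x‖ + ‖p x‖ := by
      have : T x = q x - q (p x) := by simp [hT]
      rw [this]
      exact (norm_sub_le _ _).trans (by gcongr; exact hq1 _)
    have h6 : ‖T x‖ ^ 2 ≤ 2 * (‖q x‖ ^ 2 + ‖p x‖ ^ 2) := by
      nlinarith [norm_nonneg (T x), sq_nonneg (‖q x‖ - ‖p x‖)]
    nlinarith
end

section
/- Let M be a von Neumann algebra and let p be a projection in M. Then the corner pMp is commutative if and only if for every pair of projections r, q ∈ M with r ≤ p and q ≤ p one has ‖q − r‖ ∈ {0, 1}. -/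
variable {H : Type*} [NormedAddCommGroup H] [InnerProductSpace ℂ H] [CompleteSpace H]

open Filter Topology in
/-- If all unitary conjugates of `e` along the one-parameter group generated by `k` are at
distance `0` or `1` from `e`, then `e` commutes with `k`. -/
theorem commute_of_norm_expUnitary_conj_sub {A : Type*} [CStarAlgebra A] (e : A)
    (k : selfAdjoint A)
    (h : ∀ t : ℝ, ‖(selfAdjoint.expUnitary (t • k) : A) * e *
        star (selfAdjoint.expUnitary (t • k) : A) - e‖ = 0 ∨
      ‖(selfAdjoint.expUnitary (t • k) : A) * e *
        star (selfAdjoint.expUnitary (t • k) : A) - e‖ = 1) :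
    Commute e (k : A) := by
  let u : ℝ → unitary A := fun t => selfAdjoint.expUnitary (t • k)
  have hu0 : u 0 = 1 := by simp [u]
  have hcont : Continuous fun t : ℝ => ‖(u t : A) * e * star (u t : A) - e‖ := by
    have : Continuous fun t : ℝ => (u t : A) :=
      continuous_subtype_val.comp (selfAdjoint.continuous_expUnitary.comp (by fun_prop))
    fun_prop
  have hlt : ∀ᶠ t in 𝓝 (0 : ℝ), ‖(u t : A) * e * star (u t : A) - e‖ < 1 :=
    hcont.continuousAt.eventually_lt continuousAt_const (by simp [hu0])
  have hcomm : ∀ᶠ t in 𝓝 (0 : ℝ), (u t : A) * e - e * (u t : A) = 0 := by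
    filter_upwards [hlt] with t ht
    have h0 : (u t : A) * e * star (u t : A) - e = 0 :=
      norm_eq_zero.mp ((h t).resolve_right ht.ne)
    have h1 := congr($h0 * (u t : A))
    simpa [sub_mul, mul_assoc] using h1
  have hexp : HasDerivAt (fun t : ℝ => (u t : A)) (Complex.I • (k : A)) 0 := by
    have := hasDerivAt_exp_smul_const (𝕂 := ℝ) (Complex.I • (k : A)) 0
    simpa [u, smul_comm Complex.I] using this
  have hder := (hexp.mul_const e).sub (hexp.const_mul e)
  have hzero : HasDerivAt (fun t : ℝ => (u t : A) * e - e * (u t : A)) 0 0 :=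
    (hasDerivAt_const (0 : ℝ) (0 : A)).congr_of_eventuallyEq hcomm
  have := hder.unique hzero
  rw [smul_mul_assoc, mul_smul_comm, ← smul_sub, smul_eq_zero] at this
  exact (sub_eq_zero.mp (this.resolve_left Complex.I_ne_zero)).symm

namespace VonNeumannAlgebra

/-- An operator commuting with the commutant of `M` belongs to `M`. -/
theorem mem_of_forall_commute (M : VonNeumannAlgebra H) {x : H →L[ℂ] H}
    (h : ∀ y ∈ M.commutant, Commute x y) : x ∈ M := by
  rw [← M.commutant_commutant, mem_commutant_iff]
  exact fun y hy => (h y hy).eq.symm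

theorem commute_of_mem_commutant {M : VonNeumannAlgebra H} {x y : H →L[ℂ] H}
    (hx : x ∈ M) (hy : y ∈ M.commutant) : Commute x y :=
  mem_commutant_iff.mp hy x hx

theorem smul_mem (M : VonNeumannAlgebra H) {x : H →L[ℂ] H} (c : ℂ) (hx : x ∈ M) : c • x ∈ M :=
  M.mem_of_forall_commute fun _ hy => (commute_of_mem_commutant hx hy).smul_left c

theorem real_smul_mem (M : VonNeumannAlgebra H) {x : H →L[ℂ] H} (c : ℝ) (hx : x ∈ M) :
    c • x ∈ M :=
  M.mem_of_forall_commute fun _ hy => (commute_of_mem_commutant hx hy).smul_left c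

theorem posPart_mem (M : VonNeumannAlgebra H) {d : H →L[ℂ] H} (hd : d ∈ M) : d⁺ ∈ M :=
  M.mem_of_forall_commute fun _ hy => (commute_of_mem_commutant hd hy).cfcₙ_real _

theorem exp_mem (M : VonNeumannAlgebra H) {x : H →L[ℂ] H} (hx : x ∈ M) :
    NormedSpace.exp x ∈ M :=
  M.mem_of_forall_commute fun _ hy => by
    let +nondep : NormedAlgebra ℚ (H →L[ℂ] H) := .restrictScalars ℚ ℂ _
    exact (commute_of_mem_commutant hx hy).exp_left

/-- The range projection of an element of a von Neumann algebra. -/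
theorem exists_rangeProjection (M : VonNeumannAlgebra H) {a : H →L[ℂ] H} (ha : a ∈ M) :
    ∃ e ∈ M, IsStarProjection e ∧ e * a = a ∧ ∀ x : H →L[ℂ] H, x * a = 0 → x * e = 0 := by
  let K : Submodule ℂ H := a.range.topologicalClosure
  have : CompleteSpace K := a.range.isClosed_topologicalClosure.completeSpace_coe
  have hK : IsStarProjection K.starProjection := isStarProjection_starProjection
  refine ⟨K.starProjection, ?_, hK, ?_, fun x hx => ?_⟩
  · rw [IsStarProjection.mem_iff hK]
    intro y hy
    have hy' : a.range ∈ Module.End.invtSubmodule (y : H →ₗ[ℂ] H) := by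
      rw [Module.End.mem_invtSubmodule_iff_forall_mem_of_mem]
      rintro _ ⟨v, rfl⟩
      exact ⟨y v, congr($((commute_of_mem_commutant ha hy).eq) v)⟩
    simpa [K] using Submodule.topologicalClosure_mem_invtSubmodule hy'
  · ext v
    exact K.starProjection_eq_self_iff.mpr (a.range.le_topologicalClosure ⟨v, rfl⟩)
  · have hle : K ≤ x.ker := by
      refine Submodule.topologicalClosure_minimal _ ?_ x.isClosed_ker
      rintro _ ⟨v, rfl⟩
      exact congr($hx v)
    ext v
    exact hle (K.starProjection_apply_mem v)

/-- A spectral bisection: a positive element `h ≤ c • p` of the corner of `p` can be approximated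
within `c / 2` by a multiple of a subprojection of `p`. -/
theorem exists_projection_bisection (M : VonNeumannAlgebra H) {p h : H →L[ℂ] H} (hpM : p ∈ M)
    (hp : IsStarProjection p) (hM : h ∈ M) (hph : p * h = h) {c : ℝ}
    (h0 : 0 ≤ h) (hc : h ≤ c • p) :
    ∃ e ∈ M, IsStarProjection e ∧ p * e = e ∧ 0 ≤ h - (c / 2) • e ∧
      h - (c / 2) • e ≤ (c / 2) • p := by
  set d : H →L[ℂ] H := h - (c / 2) • p with hd
  have hdM : d ∈ M := sub_mem hM (M.real_smul_mem _ hpM)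
  have hpp : p * p = p := hp.isIdempotentElem
  have hpd : p * d = d := by rw [hd, mul_sub, hph, mul_smul_comm, hpp]
  have hdsa : IsSelfAdjoint d := h0.isSelfAdjoint.sub ((IsSelfAdjoint.all _).smul hp.isSelfAdjoint)
  have hab : d⁺ - d⁻ = d := CFC.posPart_sub_negPart d
  have hba : d⁻ * d⁺ = 0 := CFC.negPart_mul_posPart d
  have ha0 : 0 ≤ d⁺ := CFC.posPart_nonneg d
  have hb0 : 0 ≤ d⁻ := CFC.negPart_nonneg d
  have haM := M.posPart_mem hdM
  set a := d⁺
  set b := d⁻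
  have hya : (1 - p) * a = 0 := by
    rw [← CStarRing.mul_star_self_eq_zero_iff, star_mul, ha0.isSelfAdjoint.star_eq]
    have h1 : a * a = d * a := by rw [← hab, sub_mul, hba, sub_zero]
    have h2 : (1 - p) * d = 0 := by rw [sub_mul, hpd, one_mul, sub_self]
    rw [mul_assoc, ← mul_assoc a a, h1, ← mul_assoc, ← mul_assoc, h2, zero_mul, zero_mul]
  obtain ⟨e, heM, he, hea, hker⟩ := M.exists_rangeProjection haM
  have hee : e * e = e := he.isIdempotentElem
  have hpe : p * e = e := by
    have := hker _ hya
    rwa [sub_mul, one_mul, sub_eq_zero, eq_comm] at this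
  have hep : e * p = e := by
    simpa [hp.isSelfAdjoint.star_eq, he.isSelfAdjoint.star_eq] using congr(star $hpe)
  have hbe : b * e = 0 := hker _ hba
  have hae : a * e = a := by
    simpa [ha0.isSelfAdjoint.star_eq, he.isSelfAdjoint.star_eq] using congr(star $hea)
  have heb : e * b = 0 := by
    simpa [hb0.isSelfAdjoint.star_eq, he.isSelfAdjoint.star_eq] using congr(star $hbe)
  have hpb : p * b = b := by
    have h1 : b = a - d := by rw [← hab]; abel
    rw [sub_mul, one_mul, sub_eq_zero] at hya
    rw [h1, mul_sub, ← hya, hpd]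
  have hbp : b * p = b := by
    simpa [hb0.isSelfAdjoint.star_eq, hp.isSelfAdjoint.star_eq] using congr(star $hpb)
  have hpa : p * a = a := by
    rw [sub_mul, one_mul, sub_eq_zero] at hya
    exact hya.symm
  have hap : a * p = a := by
    simpa [ha0.isSelfAdjoint.star_eq, hp.isSelfAdjoint.star_eq] using congr(star $hpa)
  have hupper : a ≤ (c / 2) • e := by
    have hle : d ≤ (c / 2) • p := by
      rw [hd, sub_le_iff_le_add, ← add_smul]
      simpa using hc
    have := he.isSelfAdjoint.conjugate_le_conjugate hle
    rwa [← hab, mul_sub, sub_mul, hea, hae, heb, zero_mul, sub_zero, mul_smul_comm, hep,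
      smul_mul_assoc, hee] at this
  have hlower : b ≤ (c / 2) • (p - e) := by
    have hle : -((c / 2) • p) ≤ d := by simpa [hd] using h0
    have := (hp.isSelfAdjoint.sub he.isSelfAdjoint).conjugate_le_conjugate hle
    have h1 : (p - e) * d * (p - e) = -b := by
      rw [← hab]
      simp only [mul_sub, sub_mul, hpa, hpb, hea, heb, hap, hbp, hae, hbe]
      simp
    have h2 : (p - e) * -((c / 2) • p) * (p - e) = -((c / 2) • (p - e)) := by
      rw [mul_neg, neg_mul, mul_smul_comm, smul_mul_assoc]
      simp only [mul_sub, sub_mul, hpp, hpe, hep, hee]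
      simp
    rwa [h1, h2, neg_le_neg_iff] at this
  have hh : h = a - b + (c / 2) • p := by rw [hab, hd]; abel
  refine ⟨e, heM, he, hpe, ?_, ?_⟩
  · have : h - (c / 2) • e = a + ((c / 2) • (p - e) - b) := by rw [hh, smul_sub]; abel
    rw [this]
    exact add_nonneg ha0 (sub_nonneg.mpr hlower)
  · have : (c / 2) • p - (h - (c / 2) • e) = ((c / 2) • e - a) + b := by rw [hh]; abel
    rw [← sub_nonneg, this]
    exact add_nonneg (sub_nonneg.mpr hupper) hb0

/-- An operator commuting with all subprojections of `p` in `M` commutes, up to an arbitrarily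
small error, with the positive elements of the corner of `p`. -/
theorem norm_commutator_le (M : VonNeumannAlgebra H) {p k : H →L[ℂ] H} (hpM : p ∈ M)
    (hp : IsStarProjection p)
    (hk : ∀ e ∈ M, IsStarProjection e → p * e = e → Commute e k) (n : ℕ) {h : H →L[ℂ] H} {c : ℝ}
    (hM : h ∈ M) (hph : p * h = h) (h0 : 0 ≤ h) (hc : h ≤ c • p) (hc0 : 0 ≤ c) :
    ‖h * k - k * h‖ ≤ 2 * c * ‖k‖ / 2 ^ n := by
  induction n generalizing h c with
  | zero =>
    have hn : ‖h‖ ≤ c := by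
      refine (CStarAlgebra.norm_le_norm_of_nonneg_of_le h0 hc).trans ?_
      rw [norm_smul, Real.norm_of_nonneg hc0]
      exact mul_le_of_le_one_right hc0 hp.norm_le
    calc ‖h * k - k * h‖ ≤ ‖h * k‖ + ‖k * h‖ := norm_sub_le _ _
      _ ≤ ‖h‖ * ‖k‖ + ‖k‖ * ‖h‖ := add_le_add (norm_mul_le _ _) (norm_mul_le _ _)
      _ = 2 * ‖h‖ * ‖k‖ := by ring
      _ ≤ 2 * c * ‖k‖ / 2 ^ 0 := by rw [pow_zero, div_one]; gcongr
  | succ n ih =>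
    obtain ⟨e, heM, he, hpe, hl, hu⟩ := M.exists_projection_bisection hpM hp hM hph h0 hc
    have := ih (sub_mem hM (M.real_smul_mem _ heM))
      (by rw [mul_sub, hph, mul_smul_comm, hpe]) hl hu (by positivity)
    have heq : (h - (c / 2) • e) * k - k * (h - (c / 2) • e) = h * k - k * h := by
      rw [sub_mul, mul_sub, smul_mul_assoc, mul_smul_comm, (hk e heM he hpe).eq]
      abel
    rw [heq] at this
    refine this.trans_eq ?_
    rw [pow_succ]
    field_simp

/-- An operator commuting with all subprojections of `p` in `M` commutes with the corner
of `p`. -/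
theorem commute_corner_of_commute_projections (M : VonNeumannAlgebra H) {p k : H →L[ℂ] H}
    (hpM : p ∈ M) (hp : IsStarProjection p)
    (hk : ∀ e ∈ M, IsStarProjection e → p * e = e → Commute e k) {x : H →L[ℂ] H} (hx : x ∈ M)
    (hxsa : IsSelfAdjoint x) : Commute (p * x * p) k := by
  have hpp : p * p = p := hp.isIdempotentElem
  have hpk : Commute p k := hk p hpM hp hpp
  have hr : IsSelfAdjoint (p * x * p) := by
    simpa [hp.isSelfAdjoint.star_eq] using hxsa.conjugate p
  have hle : x ≤ ‖x‖ • 1 := by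
    simpa [Algebra.algebraMap_eq_smul_one] using hxsa.le_algebraMap_norm_self
  have hge : -(‖x‖ • 1) ≤ x := by
    simpa [Algebra.algebraMap_eq_smul_one] using hxsa.neg_algebraMap_norm_le_self
  have hle' := hp.isSelfAdjoint.conjugate_le_conjugate hle
  have hge' := hp.isSelfAdjoint.conjugate_le_conjugate hge
  simp only [mul_neg, neg_mul, mul_smul_comm, smul_mul_assoc, mul_one, hpp] at hle' hge'
  set h := p * x * p + ‖x‖ • p with hh
  have hM : h ∈ M := add_mem (mul_mem (mul_mem hpM hx) hpM) (M.real_smul_mem _ hpM)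
  have hph : p * h = h := by
    rw [hh, mul_add, mul_smul_comm, hpp, ← mul_assoc, ← mul_assoc, hpp]
  have h0 : 0 ≤ h := neg_le_iff_add_nonneg.mp hge'
  have hc : h ≤ (2 * ‖x‖) • p := by
    rw [hh, two_mul, add_smul]
    gcongr
  have hlim : Filter.Tendsto (fun n : ℕ => 2 * (2 * ‖x‖) * ‖k‖ / 2 ^ n) Filter.atTop (nhds 0) :=
    tendsto_const_nhds.div_atTop (tendsto_pow_atTop_atTop_of_one_lt one_lt_two)
  have hnorm : ‖h * k - k * h‖ ≤ 0 := ge_of_tendsto' hlim fun n =>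
    M.norm_commutator_le hpM hp hk n hM hph h0 hc (by positivity)
  have hhk : Commute h k := sub_eq_zero.mp (norm_le_zero_iff.mp hnorm)
  have : p * x * p = h - ‖x‖ • p := by rw [hh]; abel
  rw [this]
  exact hhk.sub_left (hpk.smul_left _)

/-- Commutation with a corner can be checked on its compressions of self-adjoint elements. -/
theorem commute_corner_of_selfAdjoint (M : VonNeumannAlgebra H) {p z : H →L[ℂ] H}
    (h : ∀ x ∈ M, IsSelfAdjoint x → Commute (p * x * p) z) {x : H →L[ℂ] H} (hx : x ∈ M) :
    Commute (p * x * p) z := by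
  have hre : (realPart x : H →L[ℂ] H) ∈ M := by
    rw [realPart_apply_coe]
    exact M.real_smul_mem _ (add_mem hx (star_mem hx))
  have him : (imaginaryPart x : H →L[ℂ] H) ∈ M := by
    rw [imaginaryPart_apply_coe]
    exact M.smul_mem _ (M.real_smul_mem _ (sub_mem hx (star_mem hx)))
  rw [← realPart_add_I_smul_imaginaryPart x, mul_add, add_mul, mul_smul_comm, smul_mul_assoc]
  exact (h _ hre (realPart x).2).add_left ((h _ him (imaginaryPart x).2).smul_left _)

end VonNeumannAlgebra

/-- The difference of two commuting projections has norm `0` or `1`. -/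
theorem IsStarProjection.norm_sub_of_commute {A : Type*} [CStarAlgebra A] {r q : A}
    (hr : IsStarProjection r) (hq : IsStarProjection q) (hrq : Commute r q) :
    ‖q - r‖ = 0 ∨ ‖q - r‖ = 1 := by
  have hrr : r * r = r := hr.isIdempotentElem
  have hqq : q * q = q := hq.isIdempotentElem
  have hsa : IsSelfAdjoint (q - r) := hq.isSelfAdjoint.sub hr.isSelfAdjoint
  have hcomm : r * q = q * r := hrq
  have hrqr : r * (q * r) = q * r := by rw [← mul_assoc, hcomm, mul_assoc, hrr]
  have hqqr : q * (q * r) = q * r := by rw [← mul_assoc, hqq]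
  have hsq : (q - r) * (q - r) = q + r - 2 • (q * r) := by
    simp only [mul_sub, sub_mul, hrr, hqq, hcomm]
    abel
  have hidem : ((q - r) * (q - r)) * ((q - r) * (q - r)) = (q - r) * (q - r) := by
    simp only [hsq, mul_sub, sub_mul, mul_add, add_mul, hrr, hqq, hcomm, mul_smul_comm,
      smul_mul_assoc, mul_assoc, hrqr, hqqr]
    abel
  have h1 : ‖(q - r) * (q - r)‖ = ‖q - r‖ * ‖q - r‖ := by
    simpa [hsa.star_eq] using CStarRing.norm_star_mul_self (x := q - r)
  have h2 : ‖((q - r) * (q - r)) * ((q - r) * (q - r))‖ =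
      ‖(q - r) * (q - r)‖ * ‖(q - r) * (q - r)‖ := by
    simpa [hsa.star_eq] using CStarRing.norm_star_mul_self (x := (q - r) * (q - r))
  rw [hidem, h1] at h2
  rcases eq_or_ne ‖q - r‖ 0 with h | h
  · exact Or.inl h
  · right
    have h3 : ‖q - r‖ * ‖q - r‖ = 1 := mul_left_cancel₀ (mul_ne_zero h h) (by rw [← h2, mul_one])
    nlinarith [norm_nonneg (q - r)]

/-- A projection `p` in a von Neumann algebra `M` is Abelian (the corner `p M p` is
commutative) iff any two subprojections of `p` are at distance `0` or `1`. -/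
theorem abelian_iff_subproj_dist_zero_or_one (M : VonNeumannAlgebra H) (p : H →L[ℂ] H)
    (hpM : p ∈ M) (hp : IsSelfAdjoint p) (hp2 : IsIdempotentElem p) :
    (∀ x y : H →L[ℂ] H, x ∈ M → y ∈ M →
        (p * x * p) * (p * y * p) = (p * y * p) * (p * x * p)) ↔
      ∀ r q : H →L[ℂ] H, r ∈ M → q ∈ M →
        IsSelfAdjoint r → IsIdempotentElem r → r ≤ p →
        IsSelfAdjoint q → IsIdempotentElem q → q ≤ p →
        ‖q - r‖ = 0 ∨ ‖q - r‖ = 1 := by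
  have hP : IsStarProjection p := ⟨hp2, hp⟩
  have hpp : p * p = p := hp2
  constructor
  · intro hcomm r q hrM hqM hr hr2 hrp hq hq2 hqp
    have hR : IsStarProjection r := ⟨hr2, hr⟩
    have hQ : IsStarProjection q := ⟨hq2, hq⟩
    have := hcomm r q hrM hqM
    rw [hP.conjugate_of_nonneg_of_le hR.nonneg hrp,
      hP.conjugate_of_nonneg_of_le hQ.nonneg hqp] at this
    exact hR.norm_sub_of_commute hQ this
  · intro hdist x y hx hy
    refine M.commute_corner_of_selfAdjoint (fun x hx hxsa => ?_) hx
    refine (M.commute_corner_of_selfAdjoint (fun y hy hysa => ?_) hy).symm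
    refine (M.commute_corner_of_commute_projections hpM hP (fun e heM he hpe => ?_) hx hxsa).symm
    have hksa : IsSelfAdjoint (p * y * p) := by simpa [hp.star_eq] using hysa.conjugate p
    have hpk : Commute p (p * y * p) := by
      rw [commute_iff_eq, mul_assoc (p * y), hpp, ← mul_assoc, ← mul_assoc, hpp]
    refine commute_of_norm_expUnitary_conj_sub e ⟨p * y * p, hksa⟩ fun t => ?_
    set u := selfAdjoint.expUnitary (t • (⟨p * y * p, hksa⟩ : selfAdjoint (H →L[ℂ] H))) with hu
    have huM : (u : H →L[ℂ] H) ∈ M :=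
      M.exp_mem (M.smul_mem _ (M.real_smul_mem t (mul_mem (mul_mem hpM hy) hpM)))
    have hpu : Commute p (u : H →L[ℂ] H) := by
      let +nondep : NormedAlgebra ℚ (H →L[ℂ] H) := .restrictScalars ℚ ℂ _
      exact ((hpk.smul_right t).smul_right Complex.I).exp_right
    have hconj : IsStarProjection ((u : H →L[ℂ] H) * e * star (u : H →L[ℂ] H)) := by
      refine ⟨?_, he.isSelfAdjoint.conjugate _⟩
      have hee : e * e = e := he.isIdempotentElem
      rw [IsIdempotentElem, mul_assoc, ← mul_assoc (star _), ← mul_assoc (star _),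
        Unitary.coe_star_mul_self, one_mul, ← mul_assoc, mul_assoc _ e e, hee]
    refine hdist e _ heM (mul_mem (mul_mem huM heM) (star_mem huM)) he.isSelfAdjoint
      he.isIdempotentElem ((he.le_iff_mul_eq_right hP).mpr hpe) hconj.isSelfAdjoint
      hconj.isIdempotentElem ((hconj.le_iff_mul_eq_right hP).mpr ?_)
    rw [← mul_assoc, ← mul_assoc, hpu.eq, mul_assoc _ p e, hpe]
end

section
/- Let M be a von Neumann algebra, let p be a nonzero projection with p ≠ 1, and let a be a positive invertible element of norm one. Then p ≤ a if and only if pap = p, if and only if ‖(1 − r) − a‖ = 1 for every nonzero projection r ≤ p. -/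
section CStarAlgebra

variable {A : Type*} [CStarAlgebra A] [PartialOrder A] [StarOrderedRing A]

/-- If `x` is positive and the compression of `x` by `p` vanishes, then `x * p = 0`. -/
theorem mul_eq_zero_of_conjugate_eq_zero {x p : A} (hx : 0 ≤ x) (hp : IsSelfAdjoint p)
    (h : p * x * p = 0) : x * p = 0 := by
  have hs : CFC.sqrt x * p = 0 := by
    rw [← CStarRing.star_mul_self_eq_zero_iff, star_mul, hp.star_eq,
      (IsSelfAdjoint.of_nonneg (CFC.sqrt_nonneg x)).star_eq, mul_assoc, ← mul_assoc _ _ p,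
      CFC.sqrt_mul_sqrt_self x, ← mul_assoc, h]
  rw [← CFC.sqrt_mul_sqrt_self x, mul_assoc, hs, mul_zero]

theorem norm_le_of_neg_algebraMap_le_of_le_algebraMap {T : A} {k : ℝ} (hk : 0 ≤ k)
    (hT : IsSelfAdjoint T) (h₁ : -algebraMap ℝ A k ≤ T) (h₂ : T ≤ algebraMap ℝ A k) :
    ‖T‖ ≤ k := by
  rw [← map_neg, algebraMap_le_iff_le_spectrum] at h₁
  rw [le_algebraMap_iff_spectrum_le] at h₂
  rw [← cfc_id ℝ T]
  exact norm_cfc_le hk fun x hx ↦ abs_le.mpr ⟨h₁ x hx, h₂ x hx⟩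

theorem projection_le_iff_conjugate_eq {p a : A} (hp : IsStarProjection p) (ha₀ : 0 ≤ a)
    (ha : a ≤ 1) : p ≤ a ↔ p * a * p = p := by
  have hpp : p * p = p := hp.isIdempotentElem
  have hps := hp.isSelfAdjoint
  constructor
  · intro h
    refine le_antisymm ?_ ?_
    · simpa [hpp] using hps.conjugate_le_conjugate ha
    · simpa [hpp] using hps.conjugate_le_conjugate h
  · intro h
    have h₁ : (1 - a) * p = 0 := mul_eq_zero_of_conjugate_eq_zero (sub_nonneg.mpr ha) hps
      (by rw [mul_sub, sub_mul, mul_one, hpp, h, sub_self])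
    have h₂ : a * p = p := by rw [sub_mul, one_mul, sub_eq_zero] at h₁; exact h₁.symm
    have h₃ : p * a = p := by
      simpa [hps.star_eq, (IsSelfAdjoint.of_nonneg ha₀).star_eq] using congr(star $h₂)
    have h₄ := hp.one_sub.isSelfAdjoint.conjugate_nonneg ha₀
    rwa [sub_mul 1 p a, h₃, one_mul, mul_sub, mul_one, sub_mul, h₂, hpp, sub_self, sub_zero,
      sub_nonneg] at h₄

/-- A positive element below one which is bounded below by `δ` on the range of a projection `r`
satisfies a quantitative strengthening of `r ≤ d + 1`. -/
theorem projection_le_add_of_conjugate_le {r d : A} {δ : ℝ} (hr : IsStarProjection r)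
    (hd₀ : 0 ≤ d) (hd₁ : d ≤ 1) (hδ : δ ≤ 1) (h : 0 ≤ r * (d - algebraMap ℝ A δ) * r) :
    r ≤ d + algebraMap ℝ A (1 - δ / 4) := by
  have hrr : r * r = r := hr.isIdempotentElem
  have h₁ : 0 ≤ (2 - r) * d * (2 - r) :=
    ((IsSelfAdjoint.ofNat 2).sub hr.isSelfAdjoint).conjugate_nonneg hd₀
  have h₂ : 0 ≤ (1 - r) * (1 - d) * (1 - r) :=
    hr.one_sub.isSelfAdjoint.conjugate_nonneg (sub_nonneg.mpr hd₁)
  have h₃ : 0 ≤ (1 / 2 - δ / 4) • (1 - r) := smul_nonneg (by linarith) hr.one_sub.nonneg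
  have key : d + algebraMap ℝ A (1 - δ / 4) - r =
      (1 / 2 : ℝ) • d + (1 / 4 : ℝ) • ((2 - r) * d * (2 - r)) +
      (1 / 4 : ℝ) • (r * (d - algebraMap ℝ A δ) * r) +
      (1 / 2 : ℝ) • ((1 - r) * (1 - d) * (1 - r)) + (1 / 2 - δ / 4) • (1 - r) := by
    have e₂ : (2 : A) = (2 : ℝ) • (1 : A) := by rw [← Algebra.algebraMap_eq_smul_one, map_ofNat]
    simp only [e₂, Algebra.algebraMap_eq_smul_one, mul_sub, sub_mul, mul_one, one_mul,
      smul_mul_assoc, mul_smul_comm, hrr]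
    module
  rw [← sub_nonneg, key]
  have := smul_nonneg (by norm_num : (0 : ℝ) ≤ 1 / 2) hd₀
  have := smul_nonneg (by norm_num : (0 : ℝ) ≤ 1 / 4) h₁
  have := smul_nonneg (by norm_num : (0 : ℝ) ≤ 1 / 4) h
  have := smul_nonneg (by norm_num : (0 : ℝ) ≤ 1 / 2) h₂
  positivity

theorem norm_one_sub_sub_lt_one [Nontrivial A] {r a : A} {δ : ℝ} (hr : IsStarProjection r)
    (ha₀ : 0 ≤ a) (ha₁ : a ≤ 1) (hau : IsUnit a) (hδ₀ : 0 < δ) (hδ₁ : δ ≤ 1)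
    (h : 0 ≤ r * (1 - a - algebraMap ℝ A δ) * r) : ‖(1 - r) - a‖ < 1 := by
  obtain ⟨ε, hε, hεa⟩ := (CFC.exists_pos_algebraMap_le_iff (.of_nonneg ha₀)).2
    fun x hx ↦ (IsStrictlyPositive.iff_of_unital.2 ⟨ha₀, hau⟩).spectrum_pos hx
  have hlow := projection_le_add_of_conjugate_le hr (sub_nonneg.mpr ha₁)
    (sub_le_self 1 ha₀) hδ₁ h
  have hk : max (1 - ε) (1 - δ / 4) < 1 := max_lt (by linarith) (by linarith)
  refine (norm_le_of_neg_algebraMap_le_of_le_algebraMap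
    (le_max_of_le_right (by linarith)) ?_ ?_ ?_).trans_lt hk
  · exact hr.one_sub.isSelfAdjoint.sub (.of_nonneg ha₀)
  · have h₁ : algebraMap ℝ A (1 - δ / 4) ≤ algebraMap ℝ A (max (1 - ε) (1 - δ / 4)) :=
      algebraMap_mono A (le_max_right _ _)
    have h₂ := hlow.trans (add_le_add_right h₁ _)
    rw [← sub_nonneg] at h₂ ⊢
    convert h₂ using 1
    abel
  · have h₁ : algebraMap ℝ A (1 - ε) ≤ algebraMap ℝ A (max (1 - ε) (1 - δ / 4)) :=
      algebraMap_mono A (le_max_left _ _)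
    refine le_trans ?_ h₁
    rw [map_sub, map_one]
    exact sub_le_sub (sub_le_self _ hr.nonneg) hεa

theorem norm_one_sub_sub_eq_one {p r a : A} (hr : IsStarProjection r) (hr₀ : r ≠ 0)
    (hrp : r ≤ p) (ha₀ : 0 ≤ a) (ha₁ : a ≤ 1) (hpa : p ≤ a) :
    ‖(1 - r) - a‖ = 1 := by
  have hrr : r * r = r := hr.isIdempotentElem
  have hra := (projection_le_iff_conjugate_eq hr ha₀ ha₁).1 (hrp.trans hpa)
  have h₀ : (1 - a) * r = 0 := mul_eq_zero_of_conjugate_eq_zero (sub_nonneg.mpr ha₁)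
    hr.isSelfAdjoint (by rw [mul_sub, sub_mul, mul_one, hrr, hra, sub_self])
  refine le_antisymm ?_ ?_
  · refine norm_le_of_neg_algebraMap_le_of_le_algebraMap zero_le_one
      (hr.one_sub.isSelfAdjoint.sub (.of_nonneg ha₀)) ?_ ?_
    · rw [map_one, ← sub_nonneg]
      convert add_nonneg (sub_nonneg.mpr ha₁) hr.one_sub.nonneg using 1
      abel
    · rw [map_one]
      exact (sub_le_self _ ha₀).trans (sub_le_self _ hr.nonneg)
  · have h₁ : ((1 - r) - a) * r = -r := by
      rw [sub_right_comm, sub_mul, h₀, hrr, zero_sub]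
    have h₂ := norm_mul_le ((1 - r) - a) r
    rw [h₁, norm_neg] at h₂
    exact (le_mul_iff_one_le_left (norm_pos_iff.mpr hr₀)).1 h₂

/-- The positive part of `b - δ` of a self-adjoint `b` is annihilated by every left annihilator of `b`. -/
theorem mul_posPart_sub_algebraMap_eq_zero {b z : A} {δ : ℝ} (hb : IsSelfAdjoint b) (hδ : 0 < δ)
    (h : z * b = 0) : z * (b - algebraMap ℝ A δ)⁺ = 0 := by
  set e := b - algebraMap ℝ A δ with he
  have hes : IsSelfAdjoint e := hb.sub (.algebraMap A (.all δ))
  have hc : 0 ≤ e⁺ := CFC.posPart_nonneg e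
  have hcs : star e⁺ = e⁺ := (IsSelfAdjoint.of_nonneg hc).star_eq
  have hec : e * e⁺ = e⁺ * e⁺ := by
    conv_lhs => enter [1]; rw [← CFC.posPart_sub_negPart e]
    rw [sub_mul, CFC.negPart_mul_posPart, sub_zero]
  have h₁ : z * e = -(δ • z) := by
    rw [he, mul_sub, h, Algebra.algebraMap_eq_smul_one, mul_smul_comm, mul_one, zero_sub]
  have h₂ : z * e⁺ * e⁺ * star (z * e⁺) = -(δ • (z * e⁺ * star (z * e⁺))) := by
    rw [mul_assoc z, ← hec, ← mul_assoc, h₁]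
    simp
  have h₃ : 0 ≤ z * e⁺ * e⁺ * star (z * e⁺) := star_right_conjugate_nonneg hc _
  rw [h₂, neg_nonneg] at h₃
  have h₄ : δ • (z * e⁺ * star (z * e⁺)) = 0 :=
    le_antisymm h₃ (smul_nonneg hδ.le (mul_star_self_nonneg _))
  exact CStarRing.mul_star_self_eq_zero_iff _ |>.1 ((smul_eq_zero.1 h₄).resolve_left hδ.ne')

end CStarAlgebra

namespace VonNeumannAlgebra

variable {K : Type*} [NormedAddCommGroup K] [InnerProductSpace ℂ K] [CompleteSpace K]

/-- The range projection of a self-adjoint element of a von Neumann algebra. -/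
theorem exists_rangeProjection_s18 (M : VonNeumannAlgebra K) {c : K →L[ℂ] K} (hc : c ∈ M)
    (hcs : IsSelfAdjoint c) :
    ∃ r ∈ M, IsStarProjection r ∧ r * c = c ∧ (∀ z : K →L[ℂ] K, z * c = 0 → z * r = 0) ∧
      ∀ e : K →L[ℂ] K, IsSelfAdjoint e → 0 ≤ c * e * c → 0 ≤ r * e * r := by
  set U : Submodule ℂ K := c.range.topologicalClosure
  have : CompleteSpace U := c.range.isClosed_topologicalClosure.completeSpace_coe
  have hind {S : Set K} (hS : IsClosed S) (h : ∀ x, c x ∈ S) (x : K) : U.starProjection x ∈ S := by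
    have hx : U.starProjection x ∈ closure (c.range : Set K) := U.starProjection_apply_mem x
    refine closure_minimal ?_ hS hx
    rintro _ ⟨y, rfl⟩
    exact h y
  have hproj : IsStarProjection U.starProjection := isStarProjection_starProjection
  refine ⟨U.starProjection, ?_, hproj, ?_, ?_, ?_⟩
  · rw [IsStarProjection.mem_iff hproj]
    intro y hy
    rw [Submodule.range_starProjection, Module.End.mem_invtSubmodule]
    intro v hv
    have hcy : ∀ x, y (c x) = c (y x) := fun x ↦
      congr($((mem_commutant_iff.1 hy c hc).symm) x)
    have := hind (S := {v | y v ∈ U})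
      (c.range.isClosed_topologicalClosure.preimage y.continuous)
      (fun x ↦ c.range.le_topologicalClosure ⟨y x, (hcy x).symm⟩) v
    rwa [Submodule.starProjection_eq_self_iff.2 hv] at this
  · ext x
    exact Submodule.starProjection_eq_self_iff.2 (c.range.le_topologicalClosure ⟨x, rfl⟩)
  · intro z hz
    ext x
    exact hind (S := {v | z v = 0}) (isClosed_eq z.continuous continuous_const)
      (fun x ↦ congr($hz x)) x
  · intro e he h
    have hmove {s : K →L[ℂ] K} (hs : IsSelfAdjoint s) (x : K) :
        (s * e * s).reApplyInnerSelf x = e.reApplyInnerSelf (s x) := by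
      simp only [ContinuousLinearMap.reApplyInnerSelf_apply, mul_apply_eq_comp]
      rw [← ContinuousLinearMap.adjoint_inner_right, hs.adjoint_eq]
    rw [ContinuousLinearMap.nonneg_iff_isPositive, ContinuousLinearMap.isPositive_def'] at h ⊢
    refine ⟨he.conjugate_self hproj.isSelfAdjoint, fun x ↦ ?_⟩
    rw [hmove hproj.isSelfAdjoint]
    refine hind (S := {v | 0 ≤ e.reApplyInnerSelf v})
      (isClosed_le continuous_const e.reApplyInnerSelf_continuous) (fun y ↦ ?_) x
    rw [Set.mem_ofPred_eq, ← hmove hcs]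
    exact h.2 y

theorem posPart_mem_s18 (M : VonNeumannAlgebra K) {e : K →L[ℂ] K} (he : e ∈ M) : e⁺ ∈ M := by
  rw [← commutant_commutant M, mem_commutant_iff]
  intro g hg
  have h : Commute e g := mem_commutant_iff.1 hg e he
  rw [CFC.posPart_def]
  exact (h.cfcₙ_real _).eq.symm

/-- A positive element of norm larger than `δ` has a nonzero spectral projection on which it is
bounded below by `δ`. -/
theorem exists_projection_conjugate_nonneg (M : VonNeumannAlgebra K) {b : K →L[ℂ] K} {δ : ℝ}
    (hb : b ∈ M) (hb₀ : 0 ≤ b) (hδ : 0 < δ) (hδb : δ < ‖b‖) :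
    ∃ r ∈ M, IsStarProjection r ∧ r ≠ 0 ∧ (∀ z : K →L[ℂ] K, z * b = 0 → z * r = 0) ∧
      0 ≤ r * (b - algebraMap ℝ _ δ) * r := by
  have hes : IsSelfAdjoint (b - algebraMap ℝ (K →L[ℂ] K) δ) :=
    (IsSelfAdjoint.of_nonneg hb₀).sub (.algebraMap _ (.all δ))
  have heM : b - algebraMap ℝ (K →L[ℂ] K) δ ∈ M :=
    sub_mem hb (M.toStarSubalgebra.algebraMap_mem (δ : ℂ))
  set e := b - algebraMap ℝ (K →L[ℂ] K) δ with he
  have hc : 0 ≤ e⁺ := CFC.posPart_nonneg e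
  obtain ⟨r, hrM, hr, hrc, hz, hpos⟩ :=
    M.exists_rangeProjection_s18 (M.posPart_mem_s18 heM) (.of_nonneg hc)
  refine ⟨r, hrM, hr, ?_, fun z h ↦
    hz z (mul_posPart_sub_algebraMap_eq_zero (.of_nonneg hb₀) hδ h), hpos e hes ?_⟩
  · rintro rfl
    rw [zero_mul, eq_comm, CFC.posPart_eq_zero_iff e hes, he, sub_nonpos,
      ← CStarAlgebra.norm_le_iff_le_algebraMap b hδ.le hb₀] at hrc
    exact hδb.not_ge hrc
  · conv_rhs => enter [1, 2]; rw [← CFC.posPart_sub_negPart e]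
    rw [mul_sub, CFC.posPart_mul_negPart, sub_zero]
    exact (IsSelfAdjoint.of_nonneg hc).conjugate_nonneg hc

end VonNeumannAlgebra

variable {H : Type*} [NormedAddCommGroup H] [InnerProductSpace ℂ H] [CompleteSpace H]

/-- Let `p ≠ 0, 1` be a projection and `a` a positive invertible norm-one element of a
von Neumann algebra `M`. Then `p ≤ a` iff `p a p = p`, iff `‖(1 − r) − a‖ = 1` for every
nonzero projection `r ≤ p` of `M`. -/
theorem le_pos_inv_iff (M : VonNeumannAlgebra H) (p a : H →L[ℂ] H)
    (hpM : p ∈ M) (hp : IsSelfAdjoint p) (hp2 : IsIdempotentElem p)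
    (hp0 : p ≠ 0) (hp1 : p ≠ 1)
    (haM : a ∈ M) (ha : 0 ≤ a) (ha1 : ‖a‖ = 1)
    (hainv : ∃ c : H →L[ℂ] H, c ∈ M ∧ a * c = 1 ∧ c * a = 1) :
    (p ≤ a ↔ p * a * p = p) ∧
      (p ≤ a ↔
        ∀ r : H →L[ℂ] H, r ∈ M → IsSelfAdjoint r → IsIdempotentElem r → r ≠ 0 → r ≤ p →
          ‖(1 - r) - a‖ = 1) := by
  have hP : IsStarProjection p := ⟨hp2, hp⟩
  have hpp : p * p = p := hp2
  have ha₁ : a ≤ 1 := (CStarAlgebra.norm_le_one_iff_of_nonneg a ha).1 ha1.le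
  have hau : IsUnit a := by
    obtain ⟨c, -, h₁, h₂⟩ := hainv
    exact ⟨⟨a, c, h₁, h₂⟩, rfl⟩
  have : Nontrivial (H →L[ℂ] H) := ⟨p, 0, hp0⟩
  refine ⟨projection_le_iff_conjugate_eq hP ha ha₁, fun h r _ hr hr2 hr0 hrp ↦
    norm_one_sub_sub_eq_one ⟨hr2, hr⟩ hr0 hrp ha ha₁ h, fun h ↦ ?_⟩
  by_contra hpa
  have hb₀ : 0 ≤ p * (1 - a) * p := hp.conjugate_nonneg (sub_nonneg.mpr ha₁)
  have hbne : p * (1 - a) * p ≠ 0 := fun h₀ ↦ hpa <| by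
    rw [projection_le_iff_conjugate_eq hP ha ha₁, eq_comm, ← sub_eq_zero, ← h₀, mul_sub, sub_mul,
      mul_one, hpp]
  have hb₁ : ‖p * (1 - a) * p‖ ≤ 1 := by
    rw [CStarAlgebra.norm_le_one_iff_of_nonneg _ hb₀]
    refine (hp.conjugate_le_conjugate (sub_le_self 1 ha)).trans ?_
    rw [mul_one, hpp]
    exact hP.le_one
  have hbpos := norm_pos_iff.mpr hbne
  obtain ⟨r, hrM, hr, hr0, hz, hpos⟩ := M.exists_projection_conjugate_nonneg
    (mul_mem (mul_mem hpM (sub_mem (one_mem M) haM)) hpM) hb₀ (half_pos hbpos)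
    (half_lt_self hbpos)
  have hpr : p * r = r := by
    have := hz (1 - p) (by rw [← mul_assoc, ← mul_assoc, hP.one_sub_mul_self, zero_mul, zero_mul])
    rw [sub_mul, one_mul, sub_eq_zero] at this
    exact this.symm
  have hrp : r * p = r := by
    simpa [hp.star_eq, hr.isSelfAdjoint.star_eq] using congr(star $hpr)
  refine (norm_one_sub_sub_lt_one hr ha ha₁ hau (half_pos hbpos) (by linarith) ?_).ne
    (h r hrM hr.isSelfAdjoint hr.isIdempotentElem hr0 ((hr.le_iff_mul_eq_right hP).2 hpr))
  have hcomp : r * (p * (1 - a) * p) * r = r * (1 - a) * r := by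
    rw [← mul_assoc, ← mul_assoc, hrp, mul_assoc _ p r, hpr]
  rwa [mul_sub, sub_mul, hcomp, ← sub_mul, ← mul_sub] at hpos
end
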